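/- arXiv:0901.1560 — 4 statements merged into one kernel-verified Lean document; each statement's English description precedes it below -/
import Mathlib

section
/- Let R be an arithmetical ring such that (a) for every maximal ideal P, R_P is either coherent or not semicoherent, and (b) every finitely generated R-module has finite Goldie dimension. Then for each multiplicative subset S of R and each FP-injective R-module G, the localization S^{-1}G is FP-injective. -/
universe u

/-- A ring is *coherent* if every finitely generated ideal is finitely presented. -/
def IsCoherentRing (R : Type u) [CommRing R] : Prop :=
  ∀ I : Ideal R, I.FG → Module.FinitePresentation R I

/-- A ring is *semicoherent* if `Hom_R(E, F)` is (isomorphic to) a submodule of a flat module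
for every pair of injective modules `E`, `F`. -/
def IsSemicoherentRing (R : Type u) [CommRing R] : Prop :=
  ∀ (E F : Type u) [AddCommGroup E] [Module R E] [AddCommGroup F] [Module R F],
    Module.Injective R E → Module.Injective R F →
      ∃ G : ModuleCat.{u} R, Module.Flat R G ∧
        ∃ i : (E →ₗ[R] F) →ₗ[R] G, Function.Injective i

/-- An `R`-module `E` is *FP-injective* if `Ext¹_R(F, E) = 0` for every finitely
presented `R`-module `F`. -/
def IsFPInjective (R : Type u) [CommRing R] (E : Type u) [AddCommGroup E] [Module R E] : Prop :=
  ∀ (F : Type u) [AddCommGroup F] [Module R F], Module.FinitePresentation R F →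
    Subsingleton (((Ext R (ModuleCat.{u} R) 1).obj
      (Opposite.op (ModuleCat.of R F))).obj (ModuleCat.of R E))

/-- A ring is an *IF-ring* if every injective module over it is flat. -/
def IsIFRing (R : Type u) [CommRing R] : Prop :=
  ∀ (M : Type u) [AddCommGroup M] [Module R M], Module.Injective R M → Module.Flat R M

/-- `f : M →ₗ[R] E` exhibits `E` as an injective hull of `M`: `E` is injective and
`f` embeds `M` as an essential submodule of `E`. -/
def IsInjectiveHull (R : Type u) [CommRing R] (M E : Type u) [AddCommGroup M] [Module R M]
    [AddCommGroup E] [Module R E] (f : M →ₗ[R] E) : Prop :=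
  Module.Injective R E ∧ Function.Injective f ∧
    ∀ N : Submodule R E, N ≠ ⊥ → N ⊓ LinearMap.range f ≠ ⊥

/-- A module is indecomposable if it is nonzero and not the direct sum
of two nonzero submodules. -/
def IsIndecomposableModule (R : Type u) [CommRing R] (M : Type u) [AddCommGroup M]
    [Module R M] : Prop :=
  Nontrivial M ∧ ∀ A B : Submodule R M, IsCompl A B → A = ⊥ ∨ B = ⊥

/-- A module has *finite Goldie dimension* if its injective hull is a finite direct
sum of indecomposable injective modules. -/
def HasFiniteGoldieDimension (R : Type u) [CommRing R] (M : Type u) [AddCommGroup M]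
    [Module R M] : Prop :=
  ∃ (E : ModuleCat.{u} R) (f : M →ₗ[R] E), IsInjectiveHull R M E f ∧
    ∃ (n : ℕ) (D : Fin n → Submodule R E), DirectSum.IsInternal D ∧
      ∀ i, Module.Injective R (D i) ∧ IsIndecomposableModule R (D i)

/-- A commutative ring is a *valuation ring* (uniserial) if its ideals are totally
ordered by inclusion. -/
def IsChainRing (R : Type u) [CommRing R] : Prop :=
  ∀ I J : Ideal R, I ≤ J ∨ J ≤ I

/-- A commutative ring is *arithmetical* if all its localizations at maximal ideals are
valuation rings. -/
def IsArithmetical (R : Type u) [CommRing R] : Prop :=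
  ∀ (P : Ideal R) (hP : P.IsMaximal),
    haveI := hP.isPrime
    IsChainRing (Localization.AtPrime P)

/-- An `R`-module `M` is *finitely injective* if every homomorphism `A → M` from a finitely
generated submodule `A` of an arbitrary module `B` extends to `B`. -/
def IsFinitelyInjective (R : Type u) [CommRing R] (M : Type u) [AddCommGroup M]
    [Module R M] : Prop :=
  ∀ (B : Type u) [AddCommGroup B] [Module R B] (A : Submodule R B), A.FG →
    ∀ f : A →ₗ[R] M, ∃ g : B →ₗ[R] M, ∀ a : A, g a = f a

/-- A domain has *finite character* if every nonzero element lies in only finitely many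
maximal ideals. -/
def FiniteCharacter (R : Type u) [CommRing R] : Prop :=
  ∀ r : R, r ≠ 0 → {P : Ideal R | P.IsMaximal ∧ r ∈ P}.Finite


/-! ### Chain rings -/

theorem IsChainRing.dvd_or_dvd {A : Type u} [CommRing A] (hA : IsChainRing A) (a b : A) :
    a ∣ b ∨ b ∣ a := by
  rcases hA (Ideal.span {b}) (Ideal.span {a}) with h | h
  · left; rwa [Ideal.span_singleton_le_span_singleton] at h
  · right; rwa [Ideal.span_singleton_le_span_singleton] at h

/-- Over a chain ring, finitely generated ideals are principal. -/
theorem IsChainRing.fg_principal {A : Type u} [CommRing A] (hA : IsChainRing A) (I : Ideal A)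
    (hI : I.FG) : ∃ c, I = Ideal.span {c} := by
  induction I, hI using Submodule.fg_induction with
  | singleton x => exact ⟨x, rfl⟩
  | sup M₁ M₂ _ _ h₁ h₂ =>
    rcases hA M₁ M₂ with h | h
    · rw [sup_eq_right.2 h]; exact h₂
    · rw [sup_eq_left.2 h]; exact h₁

/-- A pair `a`, `b₀` of nonzero elements which are, up to regular elements, annihilators of each
other. -/
def AnnPair (A : Type u) [CommRing A] (a b : A) : Prop :=
  a ≠ 0 ∧ b ≠ 0 ∧ a * b = 0 ∧ ∀ y, y * a = 0 → ∃ s ∈ nonZeroDivisors A, ∃ w, s * y = b * w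

theorem double_ann {A : Type u} [CommRing A] (hA : IsChainRing A) (a : A) (ha : a ≠ 0) (y : A)
    (hy : ∀ b, b * a = 0 → y * b = 0) : ∃ s ∈ nonZeroDivisors A, ∃ w, s * y = a * w := by
  rcases hA.dvd_or_dvd a y with ⟨d, hd⟩ | ⟨d, hd⟩
  · exact ⟨1, one_mem _, d, by rw [hd, one_mul]⟩
  by_cases hdr : d ∈ nonZeroDivisors A
  · exact ⟨d, hdr, 1, by rw [hd]; ring⟩
  exfalso
  rw [mem_nonZeroDivisors_iff_right] at hdr
  push Not at hdr
  obtain ⟨t, htd, ht⟩ := hdr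
  rcases hA.dvd_or_dvd y t with ⟨e, he⟩ | ⟨e, he⟩
  · apply ht
    rw [he]
    apply hy
    rw [hd]
    linear_combination htd - d * he
  · apply ha
    rw [hd, he]
    linear_combination e * htd

theorem exists_ann {A : Type u} [CommRing A] (hA : IsChainRing A) (a b : A) (hab : AnnPair A a b)
    (c : A) : ∃ e, e * c = 0 ∧ ∀ y, y * e = 0 →
      ∃ s ∈ nonZeroDivisors A, ∃ w, s * y = c * w := by
  obtain ⟨ha, hb, hab0, hann⟩ := hab
  by_cases hc : c = 0
  · refine ⟨1, by simp [hc], fun y hy => ⟨1, one_mem _, 0, ?_⟩⟩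
    simpa using hy
  rcases hA.dvd_or_dvd a c with ⟨d, hd⟩ | ⟨d, hd⟩
  · rcases hA.dvd_or_dvd b d with ⟨f, hf⟩ | ⟨f, hf⟩
    · exact absurd (by rw [hd, hf]; linear_combination f * hab0) hc
    refine ⟨f, by rw [hd]; linear_combination hab0 - a * hf, fun y hy => ?_⟩
    apply double_ann hA c hc
    intro z hz
    obtain ⟨s, hs, w, hw⟩ := hann (z * d) (by rw [hd] at hz; linear_combination hz)
    have h0 : d * (s * z - f * w) = 0 := by linear_combination hw + w * hf
    have h1 : f ∣ s * z - f * w := by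
      rcases hA.dvd_or_dvd f (s * z - f * w) with h | ⟨g, hg⟩
      · exact h
      · exact absurd (by rw [hf, hg]; linear_combination g * h0) hb
    obtain ⟨g, hg⟩ := h1
    rw [mem_nonZeroDivisors_iff_right] at hs
    apply hs
    linear_combination y * hg + (w + g) * hy
  · refine ⟨d * b, by linear_combination hab0 - b * hd, fun y hy => ?_⟩
    apply double_ann hA c hc
    intro z hz
    rcases hA.dvd_or_dvd d z with ⟨v, hv⟩ | ⟨v, hv⟩
    · obtain ⟨s, hs, w, hw⟩ := hann v (by rw [hd]; linear_combination hz - c * hv)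
      rw [mem_nonZeroDivisors_iff_right] at hs
      apply hs
      rw [hv]
      linear_combination y * d * hw + w * hy
    · exact absurd (by rw [hd, hv]; linear_combination v * hz) ha

/-- Flatness over chain rings. -/
theorem flat_of_chain {A : Type u} [CommRing A] (hA : IsChainRing A) (M : Type u) [AddCommGroup M]
    [Module A M] (h : ∀ (c : A) (w : M), c • w = 0 → ∃ e m, e * c = 0 ∧ w = (e : A) • (m : M)) :
    Module.Flat A M := by
  rw [Module.Flat.iff_rTensor_injective]
  intro I hI
  obtain ⟨c, rfl⟩ := hA.fg_principal I hI
  rw [injective_iff_map_eq_zero]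
  intro z hz
  have hcm : c ∈ Ideal.span {c} := Ideal.mem_span_singleton_self c
  have key : ∃ w : M, z = (⟨c, hcm⟩ : Ideal.span {c}) ⊗ₜ[A] w := by
    clear hz
    induction z with
    | zero => exact ⟨0, by simp⟩
    | tmul x y =>
      obtain ⟨x, hx⟩ := x
      obtain ⟨r, rfl⟩ := Ideal.mem_span_singleton'.1 hx
      refine ⟨r • y, ?_⟩
      rw [← TensorProduct.smul_tmul]
      rfl
    | add x y hx hy =>
      obtain ⟨w₁, rfl⟩ := hx
      obtain ⟨w₂, rfl⟩ := hy
      exact ⟨w₁ + w₂, by rw [TensorProduct.tmul_add]⟩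
  obtain ⟨w, rfl⟩ := key
  simp at hz
  have := congrArg (TensorProduct.lid A M) hz
  simp at this
  obtain ⟨e, m, he, rfl⟩ := h c w this
  rw [← TensorProduct.smul_tmul]
  have : e • (⟨c, hcm⟩ : Ideal.span {c}) = 0 := by
    ext; simpa using he
  rw [this, TensorProduct.zero_tmul]

theorem exists_injective_embedding (Q : Type u) [CommRing Q] (X : Type u) [AddCommGroup X]
    [Module Q X] : ∃ (J : ModuleCat.{u} Q) (j : X →ₗ[Q] J), Module.Injective Q J ∧
      Function.Injective j := by
  refine ⟨CategoryTheory.Injective.under (ModuleCat.of Q X),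
    (CategoryTheory.Injective.ι (ModuleCat.of Q X)).hom, ?_, ?_⟩
  · have h : CategoryTheory.Injective (CategoryTheory.Injective.under (ModuleCat.of Q X)) :=
      inferInstance
    exact @Module.injective_module_of_injective_object Q _ _ _ _ h
  · exact (ModuleCat.mono_iff_injective _).1 inferInstance

theorem flat_of_annPair {A : Type u} [CommRing A] (hA : IsChainRing A) (a b : A)
    (hab : AnnPair A a b) (M : Type u) [AddCommGroup M] [Module A M]
    [Module (Localization (nonZeroDivisors A)) M]
    [IsScalarTower A (Localization (nonZeroDivisors A)) M]
    (hM : Module.Injective (Localization (nonZeroDivisors A)) M) : Module.Flat A M := by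
  let Q := Localization (nonZeroDivisors A)
  have reg : ∀ s ∈ nonZeroDivisors A, ∀ m : M, s • m = 0 → m = 0 := by
    intro s hs m hm
    have hu : IsUnit (algebraMap A Q s) := IsLocalization.map_units Q ⟨s, hs⟩
    rw [← algebraMap_smul Q s m] at hm
    exact (hu.smul_eq_zero).1 hm
  apply flat_of_chain hA
  intro c w hcw
  obtain ⟨e, hec, he⟩ := exists_ann hA a b hab c
  -- the map `Q / ann e → M`
  let e' : Q := algebraMap A Q e
  have hker : LinearMap.ker (LinearMap.toSpanSingleton Q Q e') ≤
      LinearMap.ker (LinearMap.toSpanSingleton Q M w) := by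
    intro q hq
    rw [LinearMap.mem_ker, LinearMap.toSpanSingleton_apply] at hq ⊢
    obtain ⟨⟨y, s⟩, hy⟩ := IsLocalization.surj (nonZeroDivisors A) q
    simp only at hy
    have h1 : y * e = 0 := by
      apply IsLocalization.injective Q le_rfl
      rw [map_mul, ← hy, map_zero, mul_right_comm, ← smul_eq_mul q, hq, zero_mul]
    obtain ⟨s', hs', v, hv⟩ := he y h1
    apply reg s s.2
    apply reg s' hs'
    have h2 : (s : A) • q • w = y • w := by
      rw [← algebraMap_smul Q (s : A), ← algebraMap_smul Q y, smul_smul, mul_comm, hy]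
    rw [h2, smul_smul, hv, mul_comm, mul_smul, hcw, smul_zero]
  -- extend
  let T := LinearMap.toSpanSingleton Q Q e'
  let φ : (Q ⧸ LinearMap.ker T) →ₗ[Q] M :=
    (LinearMap.ker T).liftQ (LinearMap.toSpanSingleton Q M w) hker
  let ι : (Q ⧸ LinearMap.ker T) →ₗ[Q] Q := (LinearMap.ker T).liftQ T le_rfl
  have hι : Function.Injective ι := by
    rw [← LinearMap.ker_eq_bot]
    exact Submodule.ker_liftQ_eq_bot' _ _ rfl
  obtain ⟨g, hg⟩ := hM.out ι hι φ
  refine ⟨e, g 1, hec, ?_⟩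
  have := hg (Submodule.Quotient.mk 1)
  simp only [ι, φ, T, Submodule.liftQ_apply, LinearMap.toSpanSingleton_apply, one_smul] at this
  rw [← this, ← algebraMap_smul Q e, ← map_smul, smul_eq_mul, mul_one]

theorem semicoherent_of_annPair {A : Type u} [CommRing A] (hA : IsChainRing A) (a b : A)
    (hab : AnnPair A a b) : IsSemicoherentRing A := by
  intro E F _ _ _ _ hE hF
  let S := nonZeroDivisors A
  let Q := Localization (nonZeroDivisors A)
  let N := E →ₗ[A] F
  -- `E` is divisible
  have hdiv : ∀ s ∈ nonZeroDivisors A, ∀ x : E, ∃ y, s • y = x := by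
    intro s hs x
    obtain ⟨g, hg⟩ := hE.out (LinearMap.toSpanSingleton A A s) (by
      rw [injective_iff_map_eq_zero]
      intro r hr
      rw [mem_nonZeroDivisors_iff_right] at hs
      exact hs r hr) (LinearMap.toSpanSingleton A E x)
    refine ⟨g 1, ?_⟩
    have := hg 1
    rw [LinearMap.toSpanSingleton_apply, LinearMap.toSpanSingleton_apply, one_smul, one_smul] at this
    rw [← map_smul, smul_eq_mul, mul_one, this]
  have htf : Function.Injective (LocalizedModule.mkLinearMap S N) := by
    rw [injective_iff_map_eq_zero]
    intro f hf
    rw [LocalizedModule.mkLinearMap_apply, ← LocalizedModule.zero_mk 1, LocalizedModule.mk_eq] at hf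
    obtain ⟨s, hs⟩ := hf
    ext x
    obtain ⟨y, rfl⟩ := hdiv s s.2 x
    have h0 : (s : A) • f = 0 := by simpa [Submonoid.smul_def] using hs
    rw [map_smul]
    exact LinearMap.congr_fun h0 y
  obtain ⟨J, j, hJ, hj⟩ := exists_injective_embedding Q (LocalizedModule S N)
  let _ : Module A J := Module.compHom J (algebraMap A Q)
  have : IsScalarTower A Q J := IsScalarTower.of_algebraMap_smul fun _ _ => rfl
  refine ⟨ModuleCat.of A J, flat_of_annPair hA a b hab J hJ,
    (j.restrictScalars A).comp (LocalizedModule.mkLinearMap S N), ?_⟩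
  exact hj.comp htf

/-- The key lemma on chain rings. -/
theorem chain_key {A : Type u} [CommRing A] (hA : IsChainRing A)
    (hc : IsCoherentRing A ∨ ¬ IsSemicoherentRing A) (a : A) (I : Ideal A) (S : Submonoid A)
    (h : ∀ b, b * a = 0 → ∃ s ∈ S, s * b ∈ I) : ∃ s ∈ S, ∀ b, b * a = 0 → s * b ∈ I := by
  by_contra hcon
  push Not at hcon
  have h1 : ∀ b, (∃ s ∈ S, s * b ∈ I) → b * a = 0 := by
    rintro b ⟨s, hs, hsb⟩
    by_contra hba
    obtain ⟨b', hb', hb'I⟩ := hcon s hs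
    rcases hA.dvd_or_dvd b b' with ⟨d, hd⟩ | ⟨d, hd⟩
    · apply hb'I
      rw [hd, ← mul_assoc]
      exact I.mul_mem_right _ hsb
    · apply hba
      rw [hd]
      linear_combination d * hb'
  have h2 : ∀ s ∈ S, ∀ b, b * (s * a) = 0 → b * a = 0 := by
    intro s hs b hb
    obtain ⟨s', hs', h'⟩ := h (s * b) (by linear_combination hb)
    exact h1 b ⟨s' * s, mul_mem hs' hs, by rwa [mul_assoc]⟩
  have ha : a ≠ 0 := by
    intro ha
    obtain ⟨s, hs, hsI⟩ := h 1 (by simp [ha])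
    obtain ⟨b, -, hb⟩ := hcon s hs
    exact hb (I.mul_mem_right _ (by simpa using hsI))
  have hreg : ∀ s ∈ S, s ∈ nonZeroDivisors A := by
    intro s hs
    rw [mem_nonZeroDivisors_iff_right]
    intro t ht
    rcases hA.dvd_or_dvd a t with ⟨d, hd⟩ | ⟨d, hd⟩
    · have := h2 s hs d (by linear_combination ht - s * hd)
      rw [hd]; linear_combination this
    · exact absurd (by simpa using h2 s hs 1 (by rw [hd]; linear_combination d * ht)) ha
  -- an element not in `Z (0 : a)`
  obtain ⟨b₀, hb₀a, hb₀⟩ : ∃ b₀, b₀ * a = 0 ∧ ∀ z b, b * a = 0 → b₀ = z * b →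
      z ∈ nonZeroDivisors A := by
    by_contra hno
    push Not at hno
    obtain ⟨b, hb, hbI⟩ := hcon 1 (one_mem _)
    obtain ⟨z, b', hb', hbz, hz⟩ := hno b hb
    obtain ⟨s, hs, hsb⟩ := h b' hb'
    apply hbI
    rcases hA.dvd_or_dvd s z with ⟨d, hd⟩ | ⟨d, hd⟩
    · have : 1 * b = d * (s * b') := by rw [hbz, hd]; ring
      rw [this]
      exact I.mul_mem_left _ hsb
    · have := hreg s hs
      rw [hd, mul_mem_nonZeroDivisors] at this
      exact absurd this.1 hz
  have : Nontrivial A := ⟨a, 0, ha⟩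
  have hpair : AnnPair A a b₀ := by
    refine ⟨ha, ?_, by rw [mul_comm]; exact hb₀a, fun y hy => ?_⟩
    · rintro rfl
      exact zero_notMem_nonZeroDivisors (hb₀ 0 0 (by simp) (by simp))
    · rcases hA.dvd_or_dvd b₀ y with ⟨d, hd⟩ | ⟨d, hd⟩
      · exact ⟨1, one_mem _, d, by rw [hd, one_mul]⟩
      · exact ⟨d, hb₀ d y hy (by rw [hd, mul_comm]), 1, by rw [hd]; ring⟩
  rcases hc with hc | hc
  · -- coherent case
    have hfp := hc (Ideal.span {a}) ⟨{a}, by simp⟩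
    let π : A →ₗ[A] Ideal.span {a} :=
      LinearMap.toSpanSingleton A _ ⟨a, Ideal.mem_span_singleton_self a⟩
    have hπ : Function.Surjective π := by
      rintro ⟨x, hx⟩
      obtain ⟨r, rfl⟩ := Ideal.mem_span_singleton'.1 hx
      exact ⟨r, rfl⟩
    have hfg := Module.FinitePresentation.fg_ker π hπ
    obtain ⟨c, hcc⟩ := hA.fg_principal _ hfg
    have hmem : ∀ b, b * a = 0 ↔ b ∈ Ideal.span {c} := by
      intro b
      rw [← hcc, LinearMap.mem_ker, ← Subtype.coe_inj]
      rfl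
    obtain ⟨s, hs, hsc⟩ := h c ((hmem c).2 (Ideal.mem_span_singleton_self c))
    obtain ⟨b, hb, hbI⟩ := hcon s hs
    obtain ⟨r, rfl⟩ := Ideal.mem_span_singleton'.1 ((hmem b).1 hb)
    apply hbI
    rw [mul_left_comm]
    exact I.mul_mem_left _ hsc
  · exact hc (semicoherent_of_annPair hA a b₀ hpair)

/-! ### Indecomposable injective modules are uniform -/

theorem exists_max_disjoint {R : Type u} [CommRing R] {D : Type u} [AddCommGroup D] [Module R D]
    (K L : Submodule R D) (h : Disjoint K L) :
    ∃ N : Submodule R D, K ≤ N ∧ Disjoint N L ∧ ∀ N', N ≤ N' → Disjoint N' L → N' = N := by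
  obtain ⟨N, hKN, hN⟩ := zorn_le_nonempty₀ {N : Submodule R D | Disjoint N L} (by
    intro c hc hchain y hy
    refine ⟨sSup c, ?_, fun z hz => le_sSup hz⟩
    rw [Set.mem_ofPred_eq, disjoint_comm]
    exact (hchain.directedOn.disjoint_sSup_right).2 fun b hb => (hc hb).symm) K h
  exact ⟨N, hKN, hN.prop, fun N' hle hd => le_antisymm (hN.2 hd hle) hle⟩

theorem uniform_of_indecomposable {R : Type u} [CommRing R] (D : Type u) [AddCommGroup D]
    [Module R D] (hinj : Module.Injective R D) (hind : IsIndecomposableModule R D)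
    (K L : Submodule R D) (hKL : Disjoint K L) : K = ⊥ ∨ L = ⊥ := by
  obtain ⟨N', hLN', hd', hmax'⟩ := exists_max_disjoint L K hKL.symm
  obtain ⟨N, hKN, hd, hmax⟩ := exists_max_disjoint K N' hd'.symm
  have hmax'' : ∀ T, N' ≤ T → Disjoint T N → T = N' := fun T h1 h2 =>
    hmax' T h1 (h2.mono_right hKN)
  -- the projection `D → D / N'` restricted to `N` is injective
  let ι : N →ₗ[R] (D ⧸ N') := N'.mkQ.comp N.subtype
  have hι : Function.Injective ι := by
    rw [injective_iff_map_eq_zero]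
    intro x hx
    have hx' : (x : D) ∈ N' := by simpa [ι] using hx
    exact Subtype.ext ((Submodule.disjoint_def.1 hd) x x.2 hx')
  obtain ⟨g, hg⟩ := hinj.out ι hι N.subtype
  let φ : D →ₗ[R] D := g.comp N'.mkQ
  have hφN : ∀ x ∈ N, φ x = x := fun x hx => hg ⟨x, hx⟩
  have hφN' : ∀ x ∈ N', φ x = 0 := fun x hx => by
    simp only [φ, LinearMap.comp_apply]
    rw [show N'.mkQ x = 0 by simpa using hx, map_zero]
  have hker : LinearMap.ker φ = N' := by
    apply hmax''
    · intro x hx; exact hφN' x hx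
    · rw [Submodule.disjoint_def]
      intro x hx hxN
      rw [← hφN x hxN]; exact hx
  have hrange : LinearMap.range φ = N := by
    apply hmax
    · intro x hx; exact ⟨x, hφN x hx⟩
    · rw [Submodule.disjoint_def]
      rintro _ ⟨y, rfl⟩ hy
      by_contra hne
      -- `T = N' + R y` meets `N`
      have hyN' : y ∉ N' := fun h => hne (hφN' y h)
      have hT : ¬ Disjoint (N' ⊔ Submodule.span R {y}) N := by
        intro hdis
        apply hyN'
        rw [← hmax'' _ le_sup_left hdis]
        exact Submodule.mem_sup_right (Submodule.mem_span_singleton_self y)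
      rw [Submodule.disjoint_def] at hT
      push Not at hT
      obtain ⟨x, hx, hxN, hx0⟩ := hT
      obtain ⟨n', hn', z, hz, rfl⟩ := Submodule.mem_sup.1 hx
      obtain ⟨r, rfl⟩ := Submodule.mem_span_singleton.1 hz
      have h1 := hφN _ hxN
      rw [map_add, hφN' n' hn', zero_add, map_smul] at h1
      apply hx0
      apply Submodule.disjoint_def.1 hd _ hxN
      rw [← h1]
      exact N'.smul_mem r hy
  have hcompl : IsCompl N N' := by
    refine ⟨hd, ?_⟩
    rw [codisjoint_iff, eq_top_iff]
    intro x _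
    rw [show x = φ x + (x - φ x) by abel]
    have hm : φ x ∈ N := hrange ▸ LinearMap.mem_range_self φ x
    refine Submodule.add_mem_sup hm ?_
    rw [← hker, LinearMap.mem_ker, map_sub, hφN _ hm, sub_self]
  rcases hind.2 N N' hcompl with h | h
  · left; exact le_bot_iff.1 (h ▸ hKN)
  · right; exact le_bot_iff.1 (h ▸ hLN')

theorem exists_maximal_regular {R : Type u} [CommRing R] (D : Type u) [AddCommGroup D]
    [Module R D] (hinj : Module.Injective R D) (hind : IsIndecomposableModule R D) :
    ∃ P : Ideal R, P.IsMaximal ∧ ∀ t ∉ P, ∀ m : D, t • m = 0 → m = 0 := by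
  have := hind.1
  obtain ⟨m₀, hm₀⟩ := exists_ne (0 : D)
  let p : Ideal R :=
    { carrier := {r | ∃ m : D, m ≠ 0 ∧ r • m = 0}
      zero_mem' := ⟨m₀, hm₀, zero_smul _ _⟩
      smul_mem' := by
        rintro c r ⟨m, hm, h⟩
        exact ⟨m, hm, by rw [smul_assoc, h, smul_zero]⟩
      add_mem' := by
        rintro r r' ⟨m, hm, h⟩ ⟨m', hm', h'⟩
        have hnd : ¬ Disjoint (Submodule.span R {m}) (Submodule.span R {m'}) := by
          intro hd
          rcases uniform_of_indecomposable D hinj hind _ _ hd with h | h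
          · exact hm (Submodule.span_singleton_eq_bot.1 h)
          · exact hm' (Submodule.span_singleton_eq_bot.1 h)
        rw [Submodule.disjoint_def] at hnd
        push Not at hnd
        obtain ⟨x, hx, hx', hx0⟩ := hnd
        refine ⟨x, hx0, ?_⟩
        obtain ⟨c, rfl⟩ := Submodule.mem_span_singleton.1 hx
        obtain ⟨c', hc'⟩ := Submodule.mem_span_singleton.1 hx'
        rw [add_smul, smul_comm, h, smul_zero, zero_add, ← hc', smul_comm, h', smul_zero] }
  have hp : p ≠ ⊤ := by
    rw [Ideal.ne_top_iff_one]
    rintro ⟨m, hm, h⟩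
    rw [one_smul] at h
    exact hm h
  obtain ⟨P, hP, hpP⟩ := Ideal.exists_le_maximal p hp
  refine ⟨P, hP, fun t ht m hm => ?_⟩
  by_contra hne
  exact ht (hpP ⟨m, hne, hm⟩)

/-- The key lemma: uniform denominators. -/
theorem global_key (R : Type u) [CommRing R]
    (harith : IsArithmetical R)
    (ha : ∀ (P : Ideal R) (hP : P.IsMaximal),
      haveI := hP.isPrime
      IsCoherentRing (Localization.AtPrime P) ∨ ¬ IsSemicoherentRing (Localization.AtPrime P))
    (hb : ∀ (M : Type u) [AddCommGroup M] [Module R M],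
      Module.Finite R M → HasFiniteGoldieDimension R M)
    (T : Submonoid R) (G : Type u) [AddCommGroup G] [Module R G] (x : G) (a : R)
    (h : ∀ b, b * a = 0 → ∃ s ∈ T, (s * b) • x = 0) :
    ∃ s ∈ T, ∀ b, b * a = 0 → (s * b) • x = 0 := by
  obtain ⟨E, f, ⟨-, hf, -⟩, n, D, hD, hDi⟩ := hb (Submodule.span R {x}) inferInstance
  classical
  let x' : Submodule.span R {x} := ⟨x, Submodule.mem_span_singleton_self x⟩
  let e := LinearEquiv.ofBijective (DirectSum.coeLinearMap D) hD
  let c : ∀ i, E →ₗ[R] D i := fun i => (DirectSum.component R (Fin n) (fun i => D i) i).comp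
    e.symm.toLinearMap
  have hc : ∀ z : E, (∀ i, c i z = 0) → z = 0 := by
    intro z hz
    have : e.symm z = 0 := by
      ext i
      have := hz i
      simp only [c, LinearMap.comp_apply] at this
      exact congrArg Subtype.val this
    simpa using this
  have key : ∀ i, ∃ s ∈ T, ∀ b, b * a = 0 → (s * b) • c i (f x') = 0 := by
    intro i
    obtain ⟨P, hP, hreg⟩ := exists_maximal_regular (D i) (hDi i).1 (hDi i).2
    have := hP.isPrime
    let A := Localization.AtPrime P
    let I : Ideal R := LinearMap.ker (LinearMap.toSpanSingleton R (D i) (c i (f x')))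
    have hI : ∀ r, r ∈ I ↔ r • c i (f x') = 0 := fun r => Iff.rfl
    have hIx : ∀ r, r • x = 0 → r ∈ I := by
      intro r hr
      rw [hI, ← map_smul, ← map_smul, show r • x' = 0 from Subtype.ext hr, map_zero, map_zero]
    obtain ⟨s, hs, hs'⟩ := chain_key (harith P hP) (ha P hP) (algebraMap R A a)
      (I.map (algebraMap R A)) (T.map (algebraMap R A)) (by
        intro q hq
        obtain ⟨⟨b, t⟩, hbt⟩ := IsLocalization.surj P.primeCompl q
        simp only at hbt
        have h1 : algebraMap R A (b * a) = algebraMap R A 0 := by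
          rw [map_mul, ← hbt, map_zero]; linear_combination (algebraMap R A t) * hq
        obtain ⟨t', ht'⟩ := (IsLocalization.eq_iff_exists P.primeCompl A).1 h1
        obtain ⟨s, hs, hsx⟩ := h (t' * b) (by rw [mul_assoc, ht', mul_zero])
        refine ⟨algebraMap R A s, Submonoid.mem_map_of_mem _ hs, ?_⟩
        have h2 := Ideal.mem_map_of_mem (algebraMap R A) (hIx _ hsx)
        have hu : IsUnit (algebraMap R A t * algebraMap R A t') :=
          (IsLocalization.map_units A t).mul (IsLocalization.map_units A t')
        rw [← Ideal.mul_unit_mem_iff_mem _ hu]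
        convert h2 using 1
        rw [map_mul, map_mul, ← hbt]
        ring)
    obtain ⟨s, hsT, rfl⟩ := hs
    refine ⟨s, hsT, fun b hb => ?_⟩
    have h3 := hs' (algebraMap R A b) (by rw [← map_mul, hb, map_zero])
    rw [← hI]
    rw [← map_mul] at h3
    rw [IsLocalization.algebraMap_mem_map_algebraMap_iff P.primeCompl] at h3
    obtain ⟨t, ht, htI⟩ := h3
    rw [hI, mul_smul] at htI
    exact hreg t ht _ htI
  choose s hs hs' using key
  refine ⟨∏ i, s i, Submonoid.prod_mem _ fun i _ => hs i, fun b hb => ?_⟩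
  have : ((∏ i, s i) * b) • x' = 0 := by
    apply hf
    rw [map_zero]
    apply hc
    intro i
    rw [map_smul, map_smul, ← Finset.prod_erase_mul _ _ (Finset.mem_univ i), mul_assoc, mul_smul,
      hs' i b hb, smul_zero]
  exact congrArg Subtype.val this

/-! ### Systems of linear equations -/

/-- Every compatible finite system of linear equations over `A` with right-hand sides in `H` is
solvable in `H`. -/
def Solvable (A : Type u) [CommRing A] (H : Type u) [AddCommGroup H] [Module A H] : Prop :=
  ∀ (m n : ℕ) (k : Fin m → Fin n → A) (h : Fin m → H),
    (∀ r : Fin m → A, (∀ j, ∑ i, r i * k i j = 0) → ∑ i, r i • h i = 0) →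
    ∃ y : Fin n → H, ∀ i, ∑ j, k i j • y j = h i

theorem exists_dvd_all {A : Type u} [CommRing A] (hA : IsChainRing A) {ι : Type*} (s : Finset ι)
    (hs : s.Nonempty) (f : ι → A) : ∃ i ∈ s, ∀ j ∈ s, f i ∣ f j := by
  classical
  induction hs using Finset.Nonempty.cons_induction with
  | singleton a => exact ⟨a, by simp, by simp⟩
  | cons a s h hs ih =>
    obtain ⟨i, hi, hij⟩ := ih
    rcases hA.dvd_or_dvd (f a) (f i) with hd | hd
    · refine ⟨a, by simp, fun j hj => ?_⟩
      rcases Finset.mem_cons.1 hj with rfl | hj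
      · exact dvd_rfl
      · exact hd.trans (hij j hj)
    · refine ⟨i, by simp [hi], fun j hj => ?_⟩
      rcases Finset.mem_cons.1 hj with rfl | hj
      · exact hd
      · exact hij j hj

theorem solvable_of_divisible {A : Type u} [CommRing A] (hA : IsChainRing A) (H : Type u)
    [AddCommGroup H] [Module A H]
    (hH : ∀ (a : A) (x : H), (∀ b, b * a = 0 → b • x = 0) → ∃ z, a • z = x) : Solvable A H := by
  intro m n
  suffices hs : ∀ (s : Finset (Fin n)) (k : Fin m → Fin n → A) (h : Fin m → H),
      (∀ i, ∀ j ∉ s, k i j = 0) →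
      (∀ r : Fin m → A, (∀ j, ∑ i, r i * k i j = 0) → ∑ i, r i • h i = 0) →
      ∃ y : Fin n → H, ∀ i, ∑ j, k i j • y j = h i from
    fun k h => hs Finset.univ k h (by simp)
  intro s
  induction hcard : s.card generalizing s with
  | zero =>
    intro k h hk hcomp
    rw [Finset.card_eq_zero] at hcard
    subst hcard
    refine ⟨0, fun i => ?_⟩
    have := hcomp (Pi.single i 1) (by intro j; simp [hk])
    simpa [Pi.single_apply, ite_smul] using this.symm
  | succ N ih =>
    intro k h hk hcomp
    rcases isEmpty_or_nonempty (Fin m) with hm | hm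
    · exact ⟨0, fun i => hm.elim i⟩
    have hne : s.Nonempty := by rw [← Finset.card_pos]; omega
    obtain ⟨⟨i₀, j₀⟩, hij, hdvd⟩ := exists_dvd_all hA ((Finset.univ : Finset (Fin m)) ×ˢ s)
      (Finset.univ_nonempty.product hne) (fun p => k p.1 p.2)
    have hj₀ : j₀ ∈ s := (Finset.mem_product.1 hij).2
    have hdvd' : ∀ i j, k i₀ j₀ ∣ k i j := by
      intro i j
      by_cases hj : j ∈ s
      · exact hdvd (i, j) (by simp [hj])
      · rw [hk i j hj]; exact dvd_zero _
    choose c hc using fun i => hdvd' i j₀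
    choose u hu using fun j => hdvd' i₀ j
    obtain ⟨y, hy⟩ := ih (s.erase j₀) (by rw [Finset.card_erase_of_mem hj₀]; omega)
      (fun i j => k i j - c i * k i₀ j) (fun i => h i - c i • h i₀) (by
        intro i j hj
        by_cases hjj : j = j₀
        · subst hjj
          rw [hc i]; ring
        · have : j ∉ s := fun h => hj (Finset.mem_erase.2 ⟨hjj, h⟩)
          rw [hk i j this, hk i₀ j this]; ring) (by
        intro r hr
        have := hcomp (r - Pi.single i₀ (∑ i, r i * c i)) (by
          intro j
          rw [← hr j]
          simp only [Pi.sub_apply, sub_mul, mul_sub, Finset.sum_sub_distrib, Pi.single_apply,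
            ite_mul, zero_mul, Finset.sum_ite_eq', Finset.mem_univ, if_true, Finset.sum_mul,
            mul_assoc])
        rw [← this]
        simp only [Pi.sub_apply, sub_smul, smul_sub, Finset.sum_sub_distrib, Pi.single_apply,
            ite_smul, zero_smul, Finset.sum_ite_eq', Finset.mem_univ, if_true, Finset.sum_smul,
            mul_smul])
    obtain ⟨z, hz⟩ := hH (k i₀ j₀) (h i₀) (by
      intro b hb
      have := hcomp (Pi.single i₀ b) (by
        intro j
        simp only [Pi.single_apply, ite_mul, zero_mul, Finset.sum_ite_eq', Finset.mem_univ,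
          if_true]
        rw [hu j, ← mul_assoc, hb, zero_mul])
      simpa [Pi.single_apply, ite_smul] using this)
    -- adjust the `j₀` coordinate
    let w : H := z - ∑ j, u j • y j
    let y' : Fin n → H := y + Pi.single j₀ w
    have hrow : ∀ i, ∑ j, k i j • y' j = ∑ j, k i j • y j + k i j₀ • w := by
      intro i
      simp [y', smul_add, Finset.sum_add_distrib, Pi.single_apply, smul_ite]
    have h0 : ∑ j, k i₀ j • y j + k i₀ j₀ • w = h i₀ := by
      simp only [w, smul_sub, hz, Finset.smul_sum, smul_smul, ← hu]
      abel
    refine ⟨y', fun i => ?_⟩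
    rw [hrow]
    have h1 := hy i
    simp only [sub_smul, mul_smul, Finset.sum_sub_distrib, ← Finset.smul_sum] at h1
    rw [← sub_eq_zero] at h1 ⊢
    rw [← h0] at h1
    rw [← h1, hc i, mul_comm, mul_smul, smul_add]
    abel

/-! ### Localization of systems -/

theorem solvable_of_local (R : Type u) [CommRing R] (H : Type u) [AddCommGroup H] [Module R H]
    (hloc : ∀ (P : Ideal R) (hP : P.IsMaximal),
      haveI := hP.isPrime
      Solvable (Localization.AtPrime P) (LocalizedModule P.primeCompl H)) : Solvable R H := by
  intro m n k h hcomp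
  let 𝔞 : Ideal R :=
    { carrier := {r | ∃ y : Fin n → H, ∀ i, ∑ j, k i j • y j = r • h i}
      zero_mem' := ⟨0, fun i => by simp⟩
      add_mem' := by
        rintro r r' ⟨y, hy⟩ ⟨y', hy'⟩
        refine ⟨y + y', fun i => ?_⟩
        simp only [Pi.add_apply, smul_add, Finset.sum_add_distrib, hy, hy', add_smul]
      smul_mem' := by
        rintro c r ⟨y, hy⟩
        refine ⟨c • y, fun i => ?_⟩
        simp only [Pi.smul_apply, smul_comm _ c, ← Finset.smul_sum, hy, smul_assoc] }
  have htop : 𝔞 = ⊤ := by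
    by_contra hne
    obtain ⟨P, hP, hle⟩ := Ideal.exists_le_maximal 𝔞 hne
    have := hP.isPrime
    let A := Localization.AtPrime P
    let f := LocalizedModule.mkLinearMap P.primeCompl H
    obtain ⟨y, hy⟩ := hloc P hP m n (fun i j => algebraMap R A (k i j)) (fun i => f (h i)) (by
      intro r hr
      obtain ⟨t, ht⟩ := IsLocalization.exist_integer_multiples_of_finite P.primeCompl r
      choose r' hr' using ht
      have h1 : ∀ j, ∃ t' : P.primeCompl, (t' : R) * ∑ i, r' i * k i j = 0 := by
        intro j
        have : algebraMap R A (∑ i, r' i * k i j) = algebraMap R A 0 := by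
          rw [map_sum, map_zero]
          have h0 := congrArg (fun q : A => (t : R) • q) (hr j)
          simp only [Finset.smul_sum, smul_zero] at h0
          rw [← h0]
          refine Finset.sum_congr rfl fun i _ => ?_
          rw [map_mul, hr' i, smul_mul_assoc]
        obtain ⟨t', ht'⟩ := (IsLocalization.eq_iff_exists P.primeCompl A).1 this
        exact ⟨t', by rw [ht', mul_zero]⟩
      choose t' ht' using h1
      let τ : P.primeCompl := ∏ j, t' j
      have h2 := hcomp (fun i => (τ : R) * r' i) (by
        intro j
        have : (τ : R) = (∏ j' ∈ Finset.univ.erase j, (t' j' : R)) * t' j := by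
          rw [Finset.prod_erase_mul _ _ (Finset.mem_univ j)]
          simp [τ]
        simp only [mul_assoc, ← Finset.mul_sum]
        rw [this, mul_assoc, ht', mul_zero])
      have h3 : ((τ : R) * (t : R)) • ∑ i, r i • f (h i) = 0 := by
        have := congrArg f h2
        rw [map_zero, map_sum] at this
        rw [← this, Finset.smul_sum]
        refine Finset.sum_congr rfl fun i _ => ?_
        rw [map_smul, mul_smul, mul_smul, ← algebraMap_smul A (r' i), hr' i, smul_assoc]
      have hu : IsUnit (algebraMap R A ((τ : R) * (t : R))) := by
        rw [map_mul]
        exact (IsLocalization.map_units A τ).mul (IsLocalization.map_units A t)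
      rw [← algebraMap_smul A] at h3
      exact (hu.smul_eq_zero).1 h3)
    -- clear denominators
    have hden : ∃ t : P.primeCompl, ∀ j, ∃ v : H, (t : R) • y j = f v := by
      have h1 : ∀ j, ∃ (v : H) (s : P.primeCompl), (s : R) • y j = f v := by
        intro j
        obtain ⟨⟨v, s⟩, hvs⟩ := IsLocalizedModule.surj P.primeCompl f (y j)
        exact ⟨v, s, hvs⟩
      choose v s hvs using h1
      refine ⟨∏ j, s j, fun j => ⟨(∏ j' ∈ Finset.univ.erase j, (s j' : R)) • v j, ?_⟩⟩
      rw [map_smul, ← hvs, smul_smul, Finset.prod_erase_mul _ _ (Finset.mem_univ j)]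
      simp
    obtain ⟨t, ht⟩ := hden
    choose v hv using ht
    have h4 : ∀ i, ∃ t' : P.primeCompl, (t' : R) • (∑ j, k i j • v j - (t : R) • h i) = 0 := by
      intro i
      have : f (∑ j, k i j • v j - (t : R) • h i) = 0 := by
        rw [map_sub, map_sum, map_smul, ← hy i, Finset.smul_sum, sub_eq_zero]
        refine Finset.sum_congr rfl fun j _ => ?_
        rw [map_smul, ← hv, algebraMap_smul, smul_comm]
      obtain ⟨c, hc⟩ := (IsLocalizedModule.eq_zero_iff P.primeCompl f).1 this
      exact ⟨c, hc⟩
    choose t' ht' using h4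
    let τ : P.primeCompl := ∏ i, t' i
    have hmem : (τ : R) * (t : R) ∈ 𝔞 := by
      refine ⟨fun j => (τ : R) • v j, fun i => ?_⟩
      have : (τ : R) = (∏ j' ∈ Finset.univ.erase i, (t' j' : R)) * t' i := by
        rw [Finset.prod_erase_mul _ _ (Finset.mem_univ i)]
        simp [τ]
      simp only [smul_comm _ (τ : R), ← Finset.smul_sum]
      rw [mul_smul, ← sub_eq_zero, ← smul_sub, this, mul_smul, ht', smul_zero]
    exact (τ * t).2 (hle hmem)
  have h1 : (1 : R) ∈ 𝔞 := htop ▸ Submodule.mem_top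
  obtain ⟨y, hy⟩ := h1
  exact ⟨y, fun i => by rw [hy i, one_smul]⟩

theorem solvable_localized (R : Type u) [CommRing R]
    (harith : IsArithmetical R)
    (ha : ∀ (P : Ideal R) (hP : P.IsMaximal),
      haveI := hP.isPrime
      IsCoherentRing (Localization.AtPrime P) ∨ ¬ IsSemicoherentRing (Localization.AtPrime P))
    (hb : ∀ (M : Type u) [AddCommGroup M] [Module R M],
      Module.Finite R M → HasFiniteGoldieDimension R M)
    (S : Submonoid R) (G : Type u) [AddCommGroup G] [Module R G]
    (hG : ∀ (a : R) (x : G), (∀ b, b * a = 0 → b • x = 0) → ∃ z, a • z = x) :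
    Solvable R (LocalizedModule S G) := by
  apply solvable_of_local
  intro P hP
  have := hP.isPrime
  apply solvable_of_divisible (harith P hP)
  intro α x hα
  let A := Localization.AtPrime P
  let H := LocalizedModule S G
  let f := LocalizedModule.mkLinearMap S G
  let f' := LocalizedModule.mkLinearMap P.primeCompl H
  have hSbij : ∀ s ∈ S, Function.Bijective (fun h : H => s • h) := by
    intro s hs
    exact (Module.End.isUnit_iff _).1 (IsLocalizedModule.map_units f ⟨s, hs⟩)
  have hPbij : ∀ s ∈ P.primeCompl, Function.Bijective
      (fun h : LocalizedModule P.primeCompl H => s • h) := by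
    intro s hs
    exact (Module.End.isUnit_iff _).1 (IsLocalizedModule.map_units f' ⟨s, hs⟩)
  have hSinj : ∀ s ∈ S, ∀ x : LocalizedModule P.primeCompl H, s • x = 0 → x = 0 := by
    intro s hs x hx
    obtain ⟨⟨h, t⟩, ht⟩ := IsLocalizedModule.surj P.primeCompl f' x
    change (t : R) • x = f' h at ht
    have h1 : f' (s • h) = 0 := by rw [map_smul, ← ht, smul_comm, hx, smul_zero]
    obtain ⟨t', ht'⟩ := (IsLocalizedModule.eq_zero_iff P.primeCompl f').1 h1
    have h2 : s • ((t' : R) • h) = s • (0 : H) := by rw [smul_comm, smul_zero]; exact ht'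
    have h3 : (t' : R) • h = 0 := (hSbij s hs).1 h2
    have h4 : f' h = 0 := (IsLocalizedModule.eq_zero_iff P.primeCompl f').2 ⟨t', h3⟩
    apply (hPbij t t.2).1
    simp only [ht, h4, smul_zero]
  have hSsurj : ∀ s ∈ S, ∀ x : LocalizedModule P.primeCompl H, ∃ z, s • z = x := by
    intro s hs x
    obtain ⟨⟨h, t⟩, ht⟩ := IsLocalizedModule.surj P.primeCompl f' x
    change (t : R) • x = f' h at ht
    obtain ⟨h', rfl⟩ := (hSbij s hs).2 h
    obtain ⟨z, hz⟩ := (hPbij t t.2).2 (f' h')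
    refine ⟨z, (hPbij t t.2).1 ?_⟩
    simp only at hz ⊢
    rw [ht, smul_comm, hz, map_smul]
  have hker : ∀ g : G, f' (f g) = 0 → ∃ s ∈ S ⊔ P.primeCompl, s • g = 0 := by
    intro g hg
    obtain ⟨t, ht⟩ := (IsLocalizedModule.eq_zero_iff P.primeCompl f').1 hg
    have ht2 : f ((t : R) • g) = 0 := by rw [map_smul]; exact ht
    obtain ⟨s, hs⟩ := (IsLocalizedModule.eq_zero_iff S f).1 ht2
    refine ⟨s * t, mul_mem (Submonoid.mem_sup_left s.2) (Submonoid.mem_sup_right t.2), ?_⟩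
    rw [mul_smul]; exact hs
  have hTinj : ∀ s ∈ S ⊔ P.primeCompl, ∀ x : LocalizedModule P.primeCompl H,
      s • x = 0 → x = 0 := by
    intro s hsT x hx
    obtain ⟨s, hs, t, ht, rfl⟩ := Submonoid.mem_sup.1 hsT
    rw [mul_smul] at hx
    apply (hPbij t ht).1
    simp only [hSinj s hs _ hx, smul_zero]
  have hTsurj : ∀ s ∈ S ⊔ P.primeCompl, ∀ x : LocalizedModule P.primeCompl H,
      ∃ z, s • z = x := by
    intro s hsT x
    obtain ⟨s, hs, t, ht, rfl⟩ := Submonoid.mem_sup.1 hsT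
    obtain ⟨z, rfl⟩ := hSsurj s hs x
    obtain ⟨w, rfl⟩ := (hPbij t ht).2 z
    exact ⟨w, mul_smul _ _ _⟩
  -- clear denominators
  obtain ⟨⟨a, t⟩, hat⟩ := IsLocalization.surj P.primeCompl α
  change α * algebraMap R A t = algebraMap R A a at hat
  obtain ⟨g, σ, hσ, hg⟩ : ∃ (g : G), ∃ σ ∈ S ⊔ P.primeCompl, σ • x = f' (f g) := by
    obtain ⟨⟨h, t⟩, ht⟩ := IsLocalizedModule.surj P.primeCompl f' x
    change (t : R) • x = f' h at ht
    obtain ⟨⟨g, s⟩, hs⟩ := IsLocalizedModule.surj S f h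
    change (s : R) • h = f g at hs
    refine ⟨g, s * t, mul_mem (Submonoid.mem_sup_left s.2) (Submonoid.mem_sup_right t.2), ?_⟩
    rw [mul_smul, ht, ← map_smul, hs]
  obtain ⟨s, hs, hsb⟩ := global_key R harith ha hb (S ⊔ P.primeCompl) G g a (by
    intro b hb
    have h1 : algebraMap R A b • x = 0 := by
      apply hα
      have hu : IsUnit (algebraMap R A t) := IsLocalization.map_units A t
      rw [← hu.mul_left_eq_zero, mul_assoc, hat, ← map_mul, hb, map_zero]
    have h2 : f' (f (b • g)) = 0 := by
      rw [map_smul, map_smul, ← hg, smul_comm]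
      rw [algebraMap_smul] at h1
      rw [h1, smul_zero]
    obtain ⟨s, hs, h3⟩ := hker _ h2
    exact ⟨s, hs, by rw [mul_smul, h3]⟩)
  obtain ⟨g', hg'⟩ := hG a (s • g) (fun b hb => by rw [smul_smul, mul_comm, hsb b hb])
  obtain ⟨z, hz⟩ := hTsurj (s * σ) (mul_mem hs hσ) (f' (f g'))
  refine ⟨(t : R) • z, ?_⟩
  rw [← sub_eq_zero]
  apply hTinj (s * σ) (mul_mem hs hσ)
  have h5 : α • (t : R) • z = a • z := by
    rw [← algebraMap_smul A (t : R), smul_smul, hat, algebraMap_smul]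
  rw [h5, smul_sub, smul_comm, hz, mul_smul, hg, ← map_smul, ← map_smul, ← map_smul, ← map_smul,
    hg', sub_self]

/-! ### `Ext¹` and extension of homomorphisms -/

/-- Every homomorphism from the kernel of `π` to `Y` extends. -/
def ExtendsKer {R : Type u} [CommRing R] {P X : Type u} [AddCommGroup P] [Module R P]
    [AddCommGroup X] [Module R X] (π : P →ₗ[R] X) (Y : Type u) [AddCommGroup Y] [Module R Y] :
    Prop :=
  ∀ φ : LinearMap.ker π →ₗ[R] Y, ∃ ψ : P →ₗ[R] Y, ∀ x : LinearMap.ker π, ψ x = φ x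

theorem ExtendsKer.transfer {R : Type u} [CommRing R] {P P' X : Type u} [AddCommGroup P]
    [Module R P] [AddCommGroup P'] [Module R P'] [AddCommGroup X] [Module R X]
    (hP : Module.Projective R P) (hP' : Module.Projective R P')
    (π : P →ₗ[R] X) (π' : P' →ₗ[R] X) (hπ : Function.Surjective π) (hπ' : Function.Surjective π')
    (Y : Type u) [AddCommGroup Y] [Module R Y] (h : ExtendsKer π Y) : ExtendsKer π' Y := by
  intro φ
  obtain ⟨α, hα⟩ := Module.projective_lifting_property π' π hπ'
  obtain ⟨β, hβ⟩ := Module.projective_lifting_property π π' hπ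
  have hα' : ∀ x, π' (α x) = π x := fun x => LinearMap.congr_fun hα x
  have hβ' : ∀ x, π (β x) = π' x := fun x => LinearMap.congr_fun hβ x
  obtain ⟨χ, hχ⟩ := h (φ.comp (α.restrict (p := LinearMap.ker π) (q := LinearMap.ker π')
    (fun x hx => by rw [LinearMap.mem_ker, hα']; exact hx)))
  let δ : P' →ₗ[R] LinearMap.ker π' := LinearMap.codRestrict (LinearMap.ker π')
    (α.comp β - LinearMap.id) (fun x => by
      simp [hα', hβ'])
  refine ⟨χ.comp β - φ.comp δ, fun x => ?_⟩
  have hx : π' x = 0 := x.2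
  have h1 := hχ ⟨β x, by rw [LinearMap.mem_ker, hβ', hx]⟩
  simp only [LinearMap.comp_apply] at h1
  rw [LinearMap.sub_apply, LinearMap.comp_apply, h1, LinearMap.comp_apply, ← map_sub]
  congr 1
  ext
  simp [δ]

open CategoryTheory in
theorem ext_one_iff (R : Type u) [CommRing R] (X Y : Type u) [AddCommGroup X] [Module R X]
    [AddCommGroup Y] [Module R Y] :
    ∃ (P : ModuleCat.{u} R) (π : P →ₗ[R] X), Module.Projective R P ∧ Function.Surjective π ∧
      (Subsingleton (((Ext R (ModuleCat.{u} R) 1).obj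
        (Opposite.op (ModuleCat.of R X))).obj (ModuleCat.of R Y)) ↔ ExtendsKer π Y) := by
  let P := projectiveResolution (ModuleCat.of R X)
  let π : P.complex.X 0 ⟶ ModuleCat.of R X := P.π.f 0
  have hex0 : ∀ x : P.complex.X 0, π.hom x = 0 → ∃ y, (P.complex.d 1 0).hom y = x := by
    have := P.exact₀
    rw [ShortComplex.moduleCat_exact_iff] at this
    exact this
  have hex1 : ∀ x : P.complex.X 1, (P.complex.d 1 0).hom x = 0 →
      ∃ y, (P.complex.d 2 1).hom y = x := by
    have := P.exact_succ 0
    rw [ShortComplex.moduleCat_exact_iff] at this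
    exact this
  have hd0 : ∀ x, π.hom ((P.complex.d 1 0).hom x) = 0 := fun x =>
    congrArg (fun (f : P.complex.X 1 ⟶ ModuleCat.of R X) => f.hom x) P.complex_d_comp_π_f_zero
  have hd1 : ∀ x, (P.complex.d 1 0).hom ((P.complex.d 2 1).hom x) = 0 := fun x =>
    congrArg (fun (f : P.complex.X 2 ⟶ P.complex.X 0) => f.hom x) (P.complex.d_comp_d 2 1 0)
  have hepi : Epi π := inferInstanceAs (Epi (P.π.f 0))
  have hproj : Projective (P.complex.X 0) := P.projective 0
  refine ⟨P.complex.X 0, π.hom, ?_, (ModuleCat.epi_iff_surjective π).1 hepi, ?_⟩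
  · exact (IsProjective.iff_projective (R := R) (P.complex.X 0)).2 hproj
  rw [← ModuleCat.isZero_iff_subsingleton,
    (P.isoExt (R := R) 1 (ModuleCat.of R Y)).isZero_iff,
    ← HomologicalComplex.exactAt_iff_isZero_homology,
    HomologicalComplex.exactAt_iff' _ 0 1 2 (by simp) (by simp),
    ShortComplex.moduleCat_exact_iff]
  have hmid : (∀ φ : P.complex.X 1 ⟶ ModuleCat.of R Y, P.complex.d 2 1 ≫ φ = 0 →
      ∃ ψ : P.complex.X 0 ⟶ ModuleCat.of R Y, P.complex.d 1 0 ≫ ψ = φ) ↔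
      ExtendsKer π.hom Y := by
    let δ : P.complex.X 1 →ₗ[R] LinearMap.ker π.hom :=
      LinearMap.codRestrict _ (P.complex.d 1 0).hom hd0
    have hδ : Function.Surjective δ := by
      rintro ⟨x, hx⟩
      obtain ⟨y, hy⟩ := hex0 x hx
      exact ⟨y, Subtype.ext hy⟩
    constructor
    · intro h φ
      obtain ⟨ψ, hψ⟩ := h (ModuleCat.ofHom (φ.comp δ)) (by
        ext x
        have : δ ((P.complex.d 2 1).hom x) = 0 := Subtype.ext (hd1 x)
        change φ (δ ((P.complex.d 2 1).hom x)) = 0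
        rw [this, map_zero])
      refine ⟨ψ.hom, fun x => ?_⟩
      obtain ⟨y, rfl⟩ := hδ x
      exact congrArg (fun (f : P.complex.X 1 ⟶ ModuleCat.of R Y) => f.hom y) hψ
    · intro h φ hφ
      have hle : LinearMap.ker δ ≤ LinearMap.ker φ.hom := by
        intro x hx
        have hx' : (P.complex.d 1 0).hom x = 0 := congrArg Subtype.val hx
        obtain ⟨y, rfl⟩ := hex1 x hx'
        exact congrArg (fun (f : P.complex.X 2 ⟶ ModuleCat.of R Y) => f.hom y) hφ
      let e := δ.quotKerEquivOfSurjective hδ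
      obtain ⟨ψ, hψ⟩ := h (((LinearMap.ker δ).liftQ φ.hom hle).comp e.symm.toLinearMap)
      refine ⟨ModuleCat.ofHom ψ, ?_⟩
      ext x
      have h1 := hψ (δ x)
      have h2 : e.symm (δ x) = Submodule.Quotient.mk x := by
        rw [LinearEquiv.symm_apply_eq]; rfl
      rw [LinearMap.comp_apply, LinearEquiv.coe_coe, h2, Submodule.liftQ_apply] at h1
      exact h1
  exact hmid

/-- `FP`-injective modules are divisible. -/
theorem IsFPInjective.divisible {R : Type u} [CommRing R] {G : Type u} [AddCommGroup G]
    [Module R G] (hG : IsFPInjective R G) (a : R) (x : G)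
    (h : ∀ b, b * a = 0 → b • x = 0) : ∃ z, a • z = x := by
  let K : Ideal R := Ideal.span {a}
  have hfp : Module.FinitePresentation R (R ⧸ K) :=
    Module.finitePresentation_of_surjective K.mkQ K.mkQ_surjective (by
      rw [Submodule.ker_mkQ]; exact ⟨{a}, by simp [K]⟩)
  obtain ⟨P, π, hP, hπ, hiff⟩ := ext_one_iff R (R ⧸ K) G
  have hE : ExtendsKer K.mkQ G := ExtendsKer.transfer hP inferInstance π K.mkQ hπ
    K.mkQ_surjective G (hiff.1 (hG _ hfp))
  have hmem : ∀ r, r * a ∈ LinearMap.ker K.mkQ := by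
    intro r
    rw [Submodule.ker_mkQ]
    exact Ideal.mem_span_singleton'.2 ⟨r, rfl⟩
  let T : R →ₗ[R] LinearMap.ker K.mkQ :=
    LinearMap.codRestrict _ (LinearMap.toSpanSingleton R R a) hmem
  have hT : Function.Surjective T := by
    rintro ⟨y, hy⟩
    have hy' := hy
    rw [Submodule.ker_mkQ] at hy'
    obtain ⟨r, hr⟩ := Ideal.mem_span_singleton'.1 hy'
    exact ⟨r, Subtype.ext hr⟩
  have hle : LinearMap.ker T ≤ LinearMap.ker (LinearMap.toSpanSingleton R G x) := by
    intro b hb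
    exact h b (congrArg Subtype.val hb)
  let e := T.quotKerEquivOfSurjective hT
  obtain ⟨ψ, hψ⟩ := hE (((LinearMap.ker T).liftQ _ hle).comp e.symm.toLinearMap)
  refine ⟨ψ 1, ?_⟩
  have h1 := hψ (T 1)
  have h2 : e.symm (T 1) = Submodule.Quotient.mk 1 := by
    rw [LinearEquiv.symm_apply_eq]; rfl
  rw [LinearMap.comp_apply, LinearEquiv.coe_coe, h2, Submodule.liftQ_apply,
    LinearMap.toSpanSingleton_apply, one_smul] at h1
  rw [← h1, ← map_smul]
  congr 1
  change a * 1 = 1 * a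
  ring

/-- If all compatible systems are solvable, the module is `FP`-injective. -/
theorem Solvable.isFPInjective {R : Type u} [CommRing R] {H : Type u} [AddCommGroup H]
    [Module R H] (hH : Solvable R H) : IsFPInjective R H := by
  intro F _ _ hF
  obtain ⟨P, π, hP, hπ, hiff⟩ := ext_one_iff R F H
  rw [hiff]
  obtain ⟨n, ρ, hρ⟩ := Module.Finite.exists_fin' R F
  refine ExtendsKer.transfer inferInstance hP ρ π hρ hπ H ?_
  intro φ
  have hfg : (LinearMap.ker ρ).FG := Module.FinitePresentation.fg_ker ρ hρ
  have : Module.Finite R (LinearMap.ker ρ) := Module.Finite.iff_fg.2 hfg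
  obtain ⟨m, κ, hκ⟩ := Module.Finite.exists_fin' R (LinearMap.ker ρ)
  let k : Fin m → LinearMap.ker ρ := fun i => κ (Pi.single i 1)
  have hκk : ∀ r, κ r = ∑ i, r i • k i := by
    intro r
    conv_lhs => rw [pi_eq_sum_univ' r, map_sum]
    refine Finset.sum_congr rfl fun i _ => ?_
    rw [map_smul]
  obtain ⟨y, hy⟩ := hH m n (fun i j => (k i : Fin n → R) j) (fun i => φ (k i)) (by
    intro r hr
    have : ∑ i, r i • k i = 0 := by
      ext j
      simpa using hr j
    simp only [← map_smul]
    rw [← map_sum, this, map_zero])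
  let ψ : (Fin n → R) →ₗ[R] H := Fintype.linearCombination R y
  have hψ : ∀ v, ψ v = ∑ j, v j • y j := fun v => Fintype.linearCombination_apply R y v
  refine ⟨ψ, fun x => ?_⟩
  obtain ⟨r, rfl⟩ := hκ x
  rw [hκk, map_sum]
  simp only [map_smul, ← hy, ← hψ]
  simp

/-- Let `R` be an arithmetical ring such that (a) each `R_P` is coherent or
not semicoherent, and (b) every finitely generated module has finite Goldie dimension.  Then
the localization of any FP-injective module at any multiplicative subset is FP-injective. -/
theorem localization_fpInjective (R : Type u) [CommRing R]
    (harith : IsArithmetical R)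
    (ha : ∀ (P : Ideal R) (hP : P.IsMaximal),
      haveI := hP.isPrime
      IsCoherentRing (Localization.AtPrime P) ∨ ¬ IsSemicoherentRing (Localization.AtPrime P))
    (hb : ∀ (M : Type u) [AddCommGroup M] [Module R M],
      Module.Finite R M → HasFiniteGoldieDimension R M)
    (S : Submonoid R) (G : Type u) [AddCommGroup G] [Module R G]
    (hG : IsFPInjective R G) :
    IsFPInjective R (LocalizedModule S G) := by

  exact (solvable_localized R harith ha hb S G hG.divisible).isFPInjective
end

section
/- Let R be an arithmetical ring such that every finitely generated R-module has finite Goldie dimension. If the localization R_P is coherent for every maximal ideal P of R, then R is coherent. -/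
universe u

theorem aux_exists_max_disjoint {R : Type u} [CommRing R] {E : Type u} [AddCommGroup E] [Module R E]
    (U V : Submodule R E) (h : Disjoint U V) :
    ∃ W : Submodule R E, U ≤ W ∧ Disjoint W V ∧ ∀ X, W ≤ X → Disjoint X V → X = W := by
  obtain ⟨W, hUW, hW⟩ := zorn_le_nonempty₀ {W : Submodule R E | Disjoint W V} (by
    intro c hc hchain y hy
    refine ⟨sSup c, ?_, fun z hz => le_sSup hz⟩
    have hd : DirectedOn (· ≤ ·) c := hchain.directedOn
    rw [Set.mem_ofPred_eq, Submodule.disjoint_def]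
    intro x hx hxV
    obtain ⟨z, hz, hxz⟩ := (Submodule.mem_sSup_of_directed ⟨y, hy⟩ hd).1 hx
    exact Submodule.disjoint_def.1 (hc hz) x hxz hxV) U h
  exact ⟨W, hUW, hW.prop, fun X hX hd => (hW.eq_of_le hd hX).symm⟩

theorem aux_uniform {R : Type u} [CommRing R] {E : Type u} [AddCommGroup E] [Module R E]
    (hinj : Module.Injective R E) (hind : IsIndecomposableModule R E)
    (U V : Submodule R E) (h : Disjoint U V) : U = ⊥ ∨ V = ⊥ := by
  obtain ⟨W, hUW, hWV, hWmax⟩ := aux_exists_max_disjoint U V h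
  obtain ⟨V', hVV', hV'W, hV'max⟩ := aux_exists_max_disjoint V W hWV.symm
  let i : W × V' →ₗ[R] E := W.subtype.coprod V'.subtype
  have hi : Function.Injective i := by
    rw [← LinearMap.ker_eq_bot, LinearMap.ker_eq_bot']
    rintro ⟨⟨w, hw⟩, ⟨v, hv⟩⟩ h0
    have h1 : w + v = 0 := by simpa [i] using h0
    have h2 : w = -v := eq_neg_of_add_eq_zero_left h1
    have h3 : w = 0 := Submodule.disjoint_def.1 hV'W w (h2 ▸ V'.neg_mem hv) hw
    subst h3
    have h4 : v = 0 := by simpa using h1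
    subst h4
    rfl
  obtain ⟨g, hg⟩ := hinj.out i hi (W.subtype.comp (LinearMap.fst R W V'))
  have hgW : ∀ w ∈ W, g w = w := by
    intro w hw
    simpa [i] using hg (⟨w, hw⟩, 0)
  have hgV : ∀ v ∈ V', g v = 0 := by
    intro v hv
    simpa [i] using hg (0, ⟨v, hv⟩)
  have hess : ∀ N : Submodule R E, N ≤ LinearMap.range g → Disjoint N W → N = ⊥ := by
    intro N hN hd
    have h1 : N.comap g = V' := by
      apply hV'max
      · intro v hv
        simp [hgV v hv]
      · rw [Submodule.disjoint_def]
        intro x hx hxW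
        have : g x ∈ N := hx
        rw [hgW x hxW] at this
        exact Submodule.disjoint_def.1 hd x this hxW
    rw [eq_bot_iff]
    intro y hy
    obtain ⟨x, rfl⟩ := hN hy
    have : x ∈ V' := h1 ▸ (show x ∈ N.comap g from hy)
    simp [hgV x this]
  have hrange : LinearMap.range g = W := by
    apply hWmax
    · intro w hw
      exact ⟨w, hgW w hw⟩
    · rw [disjoint_iff]
      apply hess _ inf_le_left
      exact hWV.symm.mono_left inf_le_right
  let p : E →ₗ[R] W := g.codRestrict W (fun x => hrange ▸ LinearMap.mem_range_self g x)
  have hc : IsCompl W (LinearMap.ker p) := LinearMap.isCompl_of_proj (f := p) (by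
    intro x
    apply Subtype.ext
    simpa [p] using hgW x x.2)
  rcases hind.2 _ _ hc with h1 | h1
  · left
    exact eq_bot_iff.2 (h1 ▸ hUW)
  · right
    rw [eq_bot_iff, ← h1]
    intro v hv
    rw [LinearMap.mem_ker]
    apply Subtype.ext
    simpa [p] using hgV v (hVV' hv)

/-- the prime of elements acting non-injectively on an indecomposable injective -/
theorem aux_prime {R : Type u} [CommRing R] {E : Type u} [AddCommGroup E] [Module R E]
    (hinj : Module.Injective R E) (hind : IsIndecomposableModule R E) :
    ∃ p : Ideal R, p.IsPrime ∧ ∀ r (x : E), x ≠ 0 → r • x = 0 → r ∈ p := by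
  have := hind.1
  refine ⟨{ carrier := {r | ∃ x : E, x ≠ 0 ∧ r • x = 0}
            add_mem' := ?_
            zero_mem' := ?_
            smul_mem' := ?_ }, ⟨?_, ?_⟩, fun r x hx h => ⟨x, hx, h⟩⟩
  · rintro r s ⟨x, hx, hrx⟩ ⟨y, hy, hsy⟩
    by_contra hcon
    have hd : Disjoint (LinearMap.ker (LinearMap.lsmul R E r))
        (LinearMap.ker (LinearMap.lsmul R E s)) := by
      rw [Submodule.disjoint_def]
      intro z hz1 hz2
      by_contra hz
      refine hcon ⟨z, hz, ?_⟩
      have h1 : r • z = 0 := hz1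
      have h2 : s • z = 0 := hz2
      rw [add_smul, h1, h2, add_zero]
    rcases aux_uniform hinj hind _ _ hd with h | h
    · exact hx ((Submodule.eq_bot_iff _).1 h x hrx)
    · exact hy ((Submodule.eq_bot_iff _).1 h y hsy)
  · obtain ⟨x, hx⟩ := exists_ne (0 : E)
    exact ⟨x, hx, zero_smul _ _⟩
  · rintro t r ⟨x, hx, hrx⟩
    exact ⟨x, hx, by rw [smul_eq_mul, mul_smul, hrx, smul_zero]⟩
  · rw [Ideal.ne_top_iff_one]
    rintro ⟨x, hx, h⟩
    exact hx (by simpa using h)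
  · rintro r s ⟨x, hx, h⟩
    by_cases hs : s • x = 0
    · exact Or.inr ⟨x, hx, hs⟩
    · exact Or.inl ⟨s • x, hs, by rw [smul_smul, h]⟩

theorem aux_cover {R : Type u} [CommRing R] (M : Type u) [AddCommGroup M] [Module R M]
    (h : HasFiniteGoldieDimension R M) :
    ∃ (n : ℕ) (p : Fin n → Ideal R), (∀ i, (p i).IsPrime) ∧
      ∀ (r : R) (x : M), x ≠ 0 → r • x = 0 → ∃ i, r ∈ p i := by
  obtain ⟨E, f, ⟨-, hf, -⟩, n, D, hD, hDi⟩ := h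
  choose p hp hp' using fun i => aux_prime (hDi i).1 (hDi i).2
  refine ⟨n, p, hp, ?_⟩
  intro r x hx hrx
  obtain ⟨y, hy⟩ := hD.2 (f x)
  have hry : r • y = 0 := by
    apply hD.1
    have hy' : DirectSum.coeLinearMap D y = f x := hy
    change DirectSum.coeLinearMap D (r • y) = DirectSum.coeLinearMap D 0
    rw [map_zero, map_smul, hy', ← map_smul, hrx, map_zero]
  have hy0 : y ≠ 0 := by
    rintro rfl
    rw [map_zero] at hy
    exact hx (hf (by rw [← hy, map_zero]))
  obtain ⟨i, hi⟩ : ∃ i, y i ≠ 0 := by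
    by_contra hcon
    push Not at hcon
    exact hy0 (DFinsupp.ext hcon)
  refine ⟨i, hp' i r (y i) hi ?_⟩
  exact DFunLike.congr_fun hry i

theorem aux_cover' {R : Type u} [CommRing R] (I : Ideal R)
    (h : HasFiniteGoldieDimension R (R ⧸ I)) :
    ∃ (n : ℕ) (p : Fin n → Ideal R), (∀ i, (p i).IsPrime) ∧
      ∀ J : Ideal R, (∀ r ∈ J, ∃ x ∉ I, r * x ∈ I) → ∃ i, J ≤ p i := by
  obtain ⟨n, p, hp, hc⟩ := aux_cover _ h
  refine ⟨n, p, hp, fun J hJ => ?_⟩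
  have : (J : Set R) ⊆ ⋃ i ∈ ((Finset.univ : Finset (Fin n)) : Set (Fin n)), (p i : Set R) := by
    intro r hr
    obtain ⟨x, hx, hrx⟩ := hJ r hr
    obtain ⟨i, hi⟩ := hc r (Ideal.Quotient.mk I x)
      (fun h => hx (Ideal.Quotient.eq_zero_iff_mem.1 h)) (by
        change Ideal.Quotient.mk I (r * x) = 0
        exact Ideal.Quotient.eq_zero_iff_mem.2 hrx)
    simp only [Set.mem_iUnion]
    exact ⟨i, by simp, hi⟩
  by_cases hn : Nonempty (Fin n)
  · obtain ⟨i0⟩ := hn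
    obtain ⟨i, -, hi⟩ := (Ideal.subset_union_prime i0 i0 (fun i _ _ _ => hp i)).1 this
    exact ⟨i, hi⟩
  · have := this J.zero_mem
    simp only [Set.mem_iUnion] at this
    exact absurd ⟨this.choose⟩ hn

theorem aux_ann_fg {L : Type u} [CommRing L] (hco : IsCoherentRing L) (a : L) :
    (LinearMap.ker (LinearMap.toSpanSingleton L L a) : Ideal L).FG := by
  have hr : (LinearMap.range (LinearMap.toSpanSingleton L L a) : Ideal L).FG :=
    Submodule.fg_range _
  have := hco _ hr
  have h := Module.FinitePresentation.fg_ker (LinearMap.toSpanSingleton L L a).rangeRestrict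
    (LinearMap.surjective_rangeRestrict _)
  rwa [LinearMap.ker_rangeRestrict] at h

theorem aux_local_zd {L : Type u} [CommRing L] [IsLocalRing L] (hch : IsChainRing L)
    (hco : IsCoherentRing L) (a c : L) (ha : a ≠ 0) (hc : c ≠ 0) (hac : c * a = 0)
    (r : L) (hr : r ∈ IsLocalRing.maximalIdeal L) : ∃ y, y ≠ 0 ∧ r * y = 0 := by
  by_contra hcon
  push Not at hcon
  have hreg : ∀ y, r * y = 0 → y = 0 := fun y hy => by
    by_contra h
    exact hcon y h hy
  have hbot := Submodule.eq_bot_of_le_smul_of_le_jacobson_bot (Ideal.span {r})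
    (LinearMap.ker (LinearMap.toSpanSingleton L L a)) (aux_ann_fg hco a) (by
      intro b hb
      have hb' : b * a = 0 := by simpa using hb
      rcases hch (Ideal.span {b}) (Ideal.span {r}) with h | h
      · obtain ⟨b', rfl⟩ := Ideal.mem_span_singleton.1 (h (Ideal.mem_span_singleton_self b))
        rw [← smul_eq_mul]
        refine Submodule.smul_mem_smul (Ideal.mem_span_singleton_self r) ?_
        have : b' * a = 0 := hreg _ (by rw [← mul_assoc, hb'])
        simpa using this
      · obtain ⟨t, ht⟩ := Ideal.mem_span_singleton.1 (h (Ideal.mem_span_singleton_self r))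
        exact absurd (hreg a (by rw [ht, mul_right_comm, hb', zero_mul])) ha) (by
      rw [Ideal.span_le, Set.singleton_subset_iff]
      exact (IsLocalRing.maximalIdeal_le_jacobson _) hr)
  exact hc ((Submodule.eq_bot_iff _).1 hbot c (by simpa using hac))

theorem aux_loc_zero {R : Type u} [CommRing R] (P : Ideal R) [P.IsPrime] (x : R) :
    algebraMap R (Localization.AtPrime P) x = 0 ↔ ∃ s, s ∉ P ∧ s * x = 0 := by
  rw [IsLocalization.map_eq_zero_iff P.primeCompl]
  exact ⟨fun ⟨s, hs⟩ => ⟨s, s.2, hs⟩, fun ⟨s, hs, h⟩ => ⟨⟨s, hs⟩, h⟩⟩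

def AuxDom {R : Type u} [CommRing R] (P : Ideal R) : Prop :=
  ∀ x y : R, x * y = 0 → (∃ s, s ∉ P ∧ s * x = 0) ∨ (∃ s, s ∉ P ∧ s * y = 0)

theorem aux_zd {R : Type u} [CommRing R] (P : Ideal R) [P.IsPrime]
    (hch : IsChainRing (Localization.AtPrime P)) (hco : IsCoherentRing (Localization.AtPrime P))
    (h : ¬ AuxDom P) (r : R) (hr : r ∈ P) : ∃ x, x ≠ 0 ∧ r * x = 0 := by
  unfold AuxDom at h
  push Not at h
  obtain ⟨c, a, hca, h1, h2⟩ := h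
  obtain ⟨y, hy, hry⟩ := aux_local_zd hch hco (algebraMap R _ a) (algebraMap R _ c)
    (fun h => by obtain ⟨s, hs, h⟩ := (aux_loc_zero P a).1 h; exact h2 s hs h)
    (fun h => by obtain ⟨s, hs, h⟩ := (aux_loc_zero P c).1 h; exact h1 s hs h)
    (by rw [← map_mul, hca, map_zero]) (algebraMap R _ r)
    ((IsLocalization.AtPrime.to_map_mem_maximal_iff (Localization.AtPrime P) P r).2 hr)
  obtain ⟨⟨x, s⟩, hx⟩ := IsLocalization.surj P.primeCompl y
  have hrx : algebraMap R (Localization.AtPrime P) (r * x) = 0 := by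
    rw [map_mul, ← hx, ← mul_assoc, hry, zero_mul]
  obtain ⟨u, hu, hux⟩ := (aux_loc_zero P _).1 hrx
  refine ⟨u * x, fun h0 => hy ?_, by rw [← hux]; ring⟩
  have h3 := (aux_loc_zero P x).2 ⟨u, hu, h0⟩
  rw [h3] at hx
  exact (IsUnit.mul_left_eq_zero (IsLocalization.map_units _ s)).1 hx

theorem aux_local_gen {R : Type u} [CommRing R] (P : Ideal R) [P.IsPrime]
    (hco : IsCoherentRing (Localization.AtPrime P)) (a : R) :
    ∃ B : Ideal R, B.FG ∧ (∀ x ∈ B, x * a = 0) ∧ ∀ x, x * a = 0 → ∃ s, s ∉ P ∧ s * x ∈ B := by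
  classical
  let L := Localization.AtPrime P
  let A : Set R := {x | x * a = 0}
  have heq : (LinearMap.ker (LinearMap.toSpanSingleton L L (algebraMap R L a)) : Ideal L)
      = Ideal.span (algebraMap R L '' A) := by
    apply le_antisymm
    · intro y hy
      have hy' : y * algebraMap R L a = 0 := by simpa using hy
      obtain ⟨⟨x, s⟩, hx⟩ := IsLocalization.surj P.primeCompl y
      have hrx : algebraMap R L (x * a) = 0 := by
        rw [map_mul, ← hx, mul_right_comm, hy', zero_mul]
      obtain ⟨u, hu, hux⟩ := (aux_loc_zero P _).1 hrx
      have hmem : algebraMap R L (u * x) ∈ Ideal.span (algebraMap R L '' A) :=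
        Ideal.subset_span ⟨u * x, by
          change u * x * a = 0
          rw [mul_assoc, hux], rfl⟩
      have h2 : algebraMap R L (u * x) = y * algebraMap R L (u * s) := by
        rw [map_mul, ← hx, map_mul]; ring
      rw [h2] at hmem
      exact (Ideal.mul_unit_mem_iff_mem _
        (IsLocalization.map_units L (⟨u, hu⟩ * s : P.primeCompl))).1 hmem
    · rw [Ideal.span_le]
      rintro _ ⟨x, hx, rfl⟩
      have : x * a = 0 := hx
      simp [← map_mul, this]
  have hfg := aux_ann_fg hco (algebraMap R L a)
  rw [heq] at hfg
  obtain ⟨t, ht, hspan⟩ := (Submodule.fg_span_iff_fg_span_finset_subset _).1 hfg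
  obtain ⟨t', ht', rfl⟩ := Finset.subset_set_image_iff.1 ht
  refine ⟨Ideal.span t', ⟨t', rfl⟩, ?_, ?_⟩
  · have : Ideal.span (t' : Set R) ≤ LinearMap.ker (LinearMap.toSpanSingleton R R a) := by
      rw [Ideal.span_le]
      intro x hx
      have : x * a = 0 := ht' hx
      simpa using this
    intro x hx
    simpa using this hx
  · intro x hx
    have h1 : algebraMap R L x ∈ (Ideal.span (t' : Set R)).map (algebraMap R L) := by
      rw [Ideal.map_span, ← Finset.coe_image]
      change _ ∈ Submodule.span _ _
      rw [← hspan]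
      exact Submodule.subset_span ⟨x, hx, rfl⟩
    rw [IsLocalization.algebraMap_mem_map_algebraMap_iff P.primeCompl] at h1
    obtain ⟨s, hs, h⟩ := h1
    exact ⟨s, hs, h⟩

theorem aux_primes_chain {R : Type u} [CommRing R] (P : Ideal R) [P.IsPrime]
    (hch : IsChainRing (Localization.AtPrime P)) (p q : Ideal R) (hp : p.IsPrime) (hq : q.IsPrime)
    (hpP : p ≤ P) (hqP : q ≤ P) : p ≤ q ∨ q ≤ p := by
  have key : ∀ p q : Ideal R, q.IsPrime → q ≤ P →
      p.map (algebraMap R (Localization.AtPrime P)) ≤ q.map (algebraMap R _) → p ≤ q := by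
    intro p q hq hqP h x hx
    have h1 := h (Ideal.mem_map_of_mem _ hx)
    rw [IsLocalization.algebraMap_mem_map_algebraMap_iff P.primeCompl] at h1
    obtain ⟨s, hs, h⟩ := h1
    exact (hq.mem_or_mem h).resolve_left (fun h => hs (hqP h))
  exact (hch _ _).imp (key p q hq hqP) (key q p hp hpP)

theorem aux_ann_fg_global (R : Type u) [CommRing R]
    (harith : IsArithmetical R)
    (hb : ∀ (M : Type u) [AddCommGroup M] [Module R M],
      Module.Finite R M → HasFiniteGoldieDimension R M)
    (hcoh : ∀ (P : Ideal R) (hP : P.IsMaximal),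
      haveI := hP.isPrime
      IsCoherentRing (Localization.AtPrime P)) (a : R) :
    (LinearMap.ker (LinearMap.toSpanSingleton R R a) : Ideal R).FG := by
  classical
  set A : Ideal R := LinearMap.ker (LinearMap.toSpanSingleton R R a) with hA
  have memA : ∀ x, x ∈ A ↔ x * a = 0 := fun x => by simp [hA]
  -- finitely many non-domain maximal ideals
  have hS : {P : Ideal R | P.IsMaximal ∧ ¬ AuxDom P}.Finite := by
    obtain ⟨n, p, hp, hc⟩ := aux_cover' (⊥ : Ideal R) (hb _ inferInstance)
    refine (Set.finite_range p).subset ?_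
    rintro P ⟨hP, hd⟩
    have := hP.isPrime
    obtain ⟨i, hi⟩ := hc P (fun r hr => by
      obtain ⟨x, hx, hrx⟩ := aux_zd P (harith P hP) (hcoh P hP) hd r hr
      exact ⟨x, by simpa using hx, by simpa using hrx⟩)
    exact ⟨i, (hP.eq_of_le (hp i).ne_top hi).symm⟩
  have hloc : ∀ P : Ideal R, ∃ B : Ideal R, B.FG ∧ B ≤ A ∧
      (P.IsMaximal → ∀ x ∈ A, ∃ s, s ∉ P ∧ s * x ∈ B) := by
    intro P
    by_cases hP : P.IsMaximal
    · have := hP.isPrime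
      obtain ⟨B, hB, hBA, h⟩ := aux_local_gen P (hcoh P hP) a
      exact ⟨B, hB, fun x hx => (memA x).2 (hBA x hx), fun _ x hx => h x ((memA x).1 hx)⟩
    · exact ⟨⊥, Submodule.fg_bot, bot_le, fun h => absurd h hP⟩
  choose B hBfg hBA hBloc using hloc
  let B0 : Ideal R := ⨆ P ∈ hS.toFinset, B P
  have hB0fg : B0.FG := Submodule.fg_biSup _ _ (fun P _ => hBfg P)
  have hB0A : B0 ≤ A := iSup₂_le fun P _ => hBA P
  have hB0loc : ∀ P : Ideal R, P.IsMaximal → ¬ AuxDom P → ∀ x ∈ A, ∃ s, s ∉ P ∧ s * x ∈ B0 := by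
    intro P hP hd x hx
    obtain ⟨s, hs, h⟩ := hBloc P hP x hx
    have hle : B P ≤ B0 := le_iSup₂_of_le P (hS.mem_toFinset.2 ⟨hP, hd⟩) le_rfl
    exact ⟨s, hs, hle h⟩
  -- finitely many minimal primes
  have hmin : B0.minimalPrimes.Finite := by
    obtain ⟨n, p, hp, hc⟩ := aux_cover' B0 (hb _ inferInstance)
    have h1 : ∀ q : B0.minimalPrimes, ∃ i, (q : Ideal R) ≤ p i := fun q =>
      hc q (fun r hr => Ideal.exists_mul_mem_of_mem_minimalPrimes q.2 hr)
    choose f hf using h1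
    have : Finite B0.minimalPrimes := Finite.of_injective f (by
      intro q q' hqq
      obtain ⟨P, hP, hpP⟩ := Ideal.exists_le_maximal (p (f q)) (hp _).ne_top
      have := hP.isPrime
      have hq : (q : Ideal R) ≤ P := (hf q).trans hpP
      have hq' : (q' : Ideal R) ≤ P := (hf q').trans (hqq ▸ hpP)
      apply Subtype.ext
      rcases aux_primes_chain P (harith P hP) q q' q.2.1.1 q'.2.1.1 hq hq' with h | h
      · exact le_antisymm h (q'.2.2 q.2.1 h)
      · exact le_antisymm (q.2.2 q'.2.1 h) h)
    exact Set.toFinite _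
  have hb' : ∀ p : Ideal R, ∃ b ∈ A, (p ⊔ A = ⊤ → ∀ P : Ideal R, P.IsMaximal → p ≤ P → b ∉ P) := by
    intro p
    by_cases h : p ⊔ A = ⊤
    · obtain ⟨y, hy, b, hbA, hyb⟩ := Submodule.mem_sup.1 (h ▸ Submodule.mem_top : (1 : R) ∈ p ⊔ A)
      refine ⟨b, hbA, fun _ P hP hpP hbP => hP.ne_top ?_⟩
      rw [Ideal.eq_top_iff_one, ← hyb]
      exact P.add_mem (hpP hy) hbP
    · exact ⟨0, A.zero_mem, fun h' => absurd h' h⟩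
  choose b hbA hbP using hb'
  let B1 : Ideal R := B0 ⊔ ⨆ p ∈ hmin.toFinset, Ideal.span {b p}
  have hB1fg : B1.FG := Submodule.FG.sup hB0fg (Submodule.fg_biSup _ _ (fun p _ => ⟨{b p}, by simp⟩))
  have hB1A : B1 ≤ A := sup_le hB0A (iSup₂_le fun p _ => by
    rw [Ideal.span_le, Set.singleton_subset_iff]; exact hbA p)
  have hB01 : B0 ≤ B1 := le_sup_left
  suffices hAB : A ≤ B1 by
    rw [le_antisymm hAB hB1A]; exact hB1fg
  intro x hx
  -- local check
  have hlocal : ∀ P : Ideal R, P.IsMaximal → ∃ s, s ∉ P ∧ s * x ∈ B1 := by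
    intro P hP
    by_cases hd : AuxDom P
    swap
    · obtain ⟨s, hs, h⟩ := hB0loc P hP hd x hx
      exact ⟨s, hs, hB01 h⟩
    rcases hd x a ((memA x).1 hx) with ⟨s, hs, h⟩ | ⟨s, hs, hsa⟩
    · exact ⟨s, hs, by rw [h]; exact B1.zero_mem⟩
    by_cases hB0P : B0 ≤ P
    swap
    · obtain ⟨t, ht, htP⟩ := Set.not_subset.1 hB0P
      exact ⟨t, htP, B1.mul_mem_right x (hB01 ht)⟩
    have hPp := hP.isPrime
    obtain ⟨p, hp, hpP⟩ := Ideal.exists_minimalPrimes_le hB0P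
    have hpprime : p.IsPrime := hp.1.1
    have htop : p ⊔ A = ⊤ := by
      by_contra hne
      obtain ⟨Q, hQ, hle⟩ := Ideal.exists_le_maximal _ hne
      have hpQ : p ≤ Q := le_sup_left.trans hle
      have hAQ : A ≤ Q := le_sup_right.trans hle
      have hsA : s ∈ A := (memA s).2 hsa
      have hsp : s ∉ p := fun h => hs (hpP h)
      by_cases hdQ : AuxDom Q
      · rcases hdQ s a hsa with ⟨u, hu, hus⟩ | ⟨u, hu, hua⟩
        · exact (hpprime.mem_or_mem (hus ▸ p.zero_mem : u * s ∈ p)).elim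
            (fun h => hu (hpQ h)) hsp
        · exact hu (hAQ ((memA u).2 hua))
      · obtain ⟨u, hu, hus⟩ := hB0loc Q hQ hdQ s hsA
        exact (hpprime.mem_or_mem (hp.1.2 hus)).elim (fun h => hu (hpQ h)) hsp
    refine ⟨b p, hbP p htop P hP hpP, B1.mul_mem_right x ?_⟩
    have hle : Ideal.span {b p} ≤ B1 :=
      le_sup_of_le_right (le_iSup₂_of_le p (hmin.mem_toFinset.2 hp) le_rfl)
    exact hle (Ideal.mem_span_singleton_self _)
  have hT : Submodule.colon B1 (Ideal.span {x} : Set R) = ⊤ := by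
    by_contra hne
    obtain ⟨Q, hQ, hle⟩ := Ideal.exists_le_maximal _ hne
    obtain ⟨s, hs, h⟩ := hlocal Q hQ
    exact hs (hle (Ideal.mem_colon_span_singleton.2 h))
  have h1 : (1 : R) ∈ Submodule.colon B1 (Ideal.span {x} : Set R) := hT ▸ Submodule.mem_top
  simpa using Ideal.mem_colon_span_singleton.1 h1

theorem aux_locally_principal {R : Type u} [CommRing R] (P : Ideal R) [P.IsPrime]
    (hch : IsChainRing (Localization.AtPrime P)) {n : ℕ} [Nonempty (Fin n)] (a : Fin n → R) :
    ∃ s, s ∉ P ∧ ∃ i, ∀ k, s * a k ∈ Ideal.span {a i} := by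
  have hd : Directed (· ≤ ·) (fun i => Ideal.span {algebraMap R (Localization.AtPrime P) (a i)}) := by
    intro i j
    rcases hch (Ideal.span {algebraMap R (Localization.AtPrime P) (a i)})
      (Ideal.span {algebraMap R (Localization.AtPrime P) (a j)}) with h | h
    · exact ⟨j, h, le_rfl⟩
    · exact ⟨i, le_rfl, h⟩
  obtain ⟨i, hi⟩ := hd.finite_le (id : Fin n → Fin n)
  have h1 : ∀ k, ∃ s, s ∉ P ∧ s * a k ∈ Ideal.span {a i} := by
    intro k
    have h2 : algebraMap R (Localization.AtPrime P) (a k) ∈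
        (Ideal.span {a i}).map (algebraMap R (Localization.AtPrime P)) := by
      rw [Ideal.map_span, Set.image_singleton]
      exact hi k (Ideal.mem_span_singleton_self _)
    rw [IsLocalization.algebraMap_mem_map_algebraMap_iff P.primeCompl] at h2
    obtain ⟨s, hs, h⟩ := h2
    exact ⟨s, hs, h⟩
  choose s hs hsa using h1
  refine ⟨∏ k, s k, (P.primeCompl.prod_mem fun k _ => hs k : ∏ k, s k ∈ P.primeCompl), i,
    fun k => ?_⟩
  obtain ⟨c, hc⟩ := Finset.dvd_prod_of_mem s (Finset.mem_univ k)
  rw [hc, mul_right_comm]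
  exact Ideal.mul_mem_right _ _ (hsa k)

theorem aux_ker_fg {R : Type u} [CommRing R] (harith : IsArithmetical R)
    (hann : ∀ a : R, (LinearMap.ker (LinearMap.toSpanSingleton R R a) : Ideal R).FG)
    {n : ℕ} (a : Fin n → R) : (LinearMap.ker (Fintype.linearCombination R a)).FG := by
  classical
  rcases isEmpty_or_nonempty (Fin n) with hn | hn
  · rw [Subsingleton.elim (LinearMap.ker (Fintype.linearCombination R a)) ⊥]
    exact Submodule.fg_bot
  let T : Set R := {s | ∃ i, ∀ k, s * a k ∈ Ideal.span {a i}}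
  have hT : (1 : R) ∈ Submodule.span R T := by
    change (1 : R) ∈ Ideal.span T
    rw [← Ideal.eq_top_iff_one]
    by_contra hne
    obtain ⟨Q, hQ, hle⟩ := Ideal.exists_le_maximal _ hne
    have := hQ.isPrime
    obtain ⟨s, hs, h⟩ := aux_locally_principal Q (harith Q hQ) a
    exact hs (hle (Ideal.subset_span h))
  obtain ⟨t, htT, ht1⟩ := Submodule.mem_span_finite_of_mem_span hT
  have hc : ∀ s : t, ∃ i, ∃ c : Fin n → R, ∀ k, s.1 * a k = a i * c k := by
    intro s
    obtain ⟨i, hi⟩ := htT s.2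
    choose c hc using fun k => Ideal.mem_span_singleton.1 (hi k)
    exact ⟨i, c, hc⟩
  choose i c hc using hc
  let e : Fin n → (Fin n → R) := fun k => Pi.single k 1
  let G1 : Submodule R (Fin n → R) :=
    Submodule.span R (Set.range fun q : t × Fin n => q.1.1 • e q.2 - c q.1 q.2 • e (i q.1))
  let G2 : Submodule R (Fin n → R) := ⨆ j : Fin n,
    Submodule.map (LinearMap.toSpanSingleton R (Fin n → R) (e j))
      (LinearMap.ker (LinearMap.toSpanSingleton R R (a j)))
  have he : ∀ k, Fintype.linearCombination R a (e k) = a k := by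
    intro k
    simp [e]
  have hG : G1 ⊔ G2 = LinearMap.ker (Fintype.linearCombination R a) := by
    apply le_antisymm
    · refine sup_le ?_ (iSup_le fun j => ?_)
      · rw [Submodule.span_le]
        rintro _ ⟨⟨s, k⟩, rfl⟩
        have := hc s k
        simp only [SetLike.mem_coe, LinearMap.mem_ker, map_sub, map_smul, he, smul_eq_mul]
        rw [this]; ring
      · rintro _ ⟨r, hr, rfl⟩
        have hr' : r * a j = 0 := by simpa using hr
        rw [LinearMap.mem_ker, LinearMap.toSpanSingleton_apply, map_smul, he, smul_eq_mul, hr']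
    · intro x hx
      have hx' : ∑ k, x k * a k = 0 := by
        simpa [Fintype.linearCombination_apply] using hx
      have hle : Submodule.span R (t : Set R) ≤
          (G1 ⊔ G2).comap (LinearMap.toSpanSingleton R (Fin n → R) x) := by
        rw [Submodule.span_le]
        intro s hs
        change s • x ∈ G1 ⊔ G2
        let s' : t := ⟨s, hs⟩
        have hdec : s • x = ∑ k, x k • (s • e k - c s' k • e (i s')) +
            (∑ k, x k * c s' k) • e (i s') := by
          have hxe : x = ∑ k, x k • e k := by
            ext j
            simp [e, Finset.sum_apply, Pi.single_apply]
          conv_lhs => rw [hxe]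
          rw [Finset.smul_sum, Finset.sum_smul, ← Finset.sum_add_distrib]
          refine Finset.sum_congr rfl fun k _ => ?_
          rw [smul_sub, smul_smul, smul_smul, smul_smul, mul_comm, sub_add_cancel]
        rw [hdec]
        refine Submodule.add_mem_sup (Submodule.sum_mem _ fun k _ => Submodule.smul_mem _ _
          (Submodule.subset_span ⟨(s', k), rfl⟩)) ?_
        refine Submodule.mem_iSup_of_mem (i s') ⟨∑ k, x k * c s' k, ?_, rfl⟩
        have : (∑ k, x k * c s' k) * a (i s') = 0 := by
          have h0 : ∑ k, s * (x k * a k) = 0 := by rw [← Finset.mul_sum, hx', mul_zero]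
          rw [Finset.sum_mul, ← h0]
          refine Finset.sum_congr rfl fun k _ => ?_
          have := hc s' k
          calc x k * c s' k * a (i s') = x k * (a (i s') * c s' k) := by ring
            _ = x k * (s * a k) := by rw [← this]
            _ = _ := by ring
        exact this
      have := hle ht1
      simpa using this
  rw [← hG]
  refine Submodule.FG.sup (Submodule.fg_span (Set.finite_range _)) ?_
  exact Submodule.fg_iSup _ fun j => (hann (a j)).map _

/-- Let `R` be an arithmetical ring such that every finitely generated
module has finite Goldie dimension.  If `R_P` is coherent for every maximal ideal `P`,
then `R` is coherent. -/
theorem coherent_of_localizations_coherent (R : Type u) [CommRing R]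
    (harith : IsArithmetical R)
    (hb : ∀ (M : Type u) [AddCommGroup M] [Module R M],
      Module.Finite R M → HasFiniteGoldieDimension R M)
    (hcoh : ∀ (P : Ideal R) (hP : P.IsMaximal),
      haveI := hP.isPrime
      IsCoherentRing (Localization.AtPrime P)) :
    IsCoherentRing R := by
  intro I hI
  obtain ⟨n, a, ha⟩ := Submodule.fg_iff_exists_fin_generating_family.1 hI
  have hr : LinearMap.range (Fintype.linearCombination R a) = I := by
    rw [Fintype.range_linearCombination, ha]
  subst hr
  refine Module.finitePresentation_of_surjective
    (Fintype.linearCombination R a).rangeRestrict (LinearMap.surjective_rangeRestrict _) ?_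
  rw [LinearMap.ker_rangeRestrict]
  exact aux_ker_fg harith (aux_ann_fg_global R harith hb hcoh) a
end

section
/- Let R be a Prüfer domain of finite character. Then for every injective R-module G and every multiplicative subset S of R, the localization S^{-1}G is an injective R-module. -/
universe u

theorem chain_aux {R : Type u} [CommRing R] [IsDomain R] (hp : IsArithmetical R)
    (M : Ideal R) (hM : M.IsMaximal) (b c : R) :
    (∃ t, t ∉ M ∧ ∃ r, t * b = r * c) ∨ (∃ t, t ∉ M ∧ ∃ r, t * c = r * b) := by
  haveI := hM.isPrime
  have key : ∀ b c : R,
      Ideal.span {algebraMap R (Localization.AtPrime M) b} ≤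
        Ideal.span {algebraMap R (Localization.AtPrime M) c} →
      ∃ t, t ∉ M ∧ ∃ r, t * b = r * c := by
    intro b c h
    rw [Ideal.span_singleton_le_span_singleton] at h
    obtain ⟨z, hz⟩ := h
    obtain ⟨⟨r, t⟩, hrt⟩ := IsLocalization.surj M.primeCompl z
    refine ⟨t, t.2, r, ?_⟩
    apply IsLocalization.injective (Localization.AtPrime M) M.primeCompl_le_nonZeroDivisors
    simp only at hrt
    rw [map_mul, map_mul, hz, ← hrt]
    ring
  rcases hp M hM (Ideal.span {algebraMap R (Localization.AtPrime M) b})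
    (Ideal.span {algebraMap R (Localization.AtPrime M) c}) with h | h
  · exact Or.inl (key _ _ h)
  · exact Or.inr (key _ _ h)

/-- The local construction used when the localized ideal is principal. -/
def localPrincipal {R : Type u} [CommRing R] {G : Type u} [AddCommGroup G] [Module R G]
    (M : Ideal R) [M.IsPrime] (x₀ : R × G) : Submodule R (R × G) where
  carrier := {x | ∃ t, t ∉ M ∧ ∃ r : R, t • x = r • x₀}
  zero_mem' := ⟨1, (Ideal.ne_top_iff_one M).1 Ideal.IsPrime.ne_top', 0, by simp⟩
  add_mem' := by
    rintro x y ⟨t, ht, r, h⟩ ⟨t', ht', r', h'⟩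
    refine ⟨t * t', M.primeCompl.mul_mem ht ht', t' * r + t * r', ?_⟩
    rw [smul_add, add_smul, mul_smul t' r, ← h, mul_smul t r', ← h', mul_comm t t', mul_smul,
      mul_comm t' t, mul_smul]
  smul_mem' := by
    rintro c x ⟨t, ht, r, h⟩
    exact ⟨t, ht, c * r, by rw [smul_comm, h, mul_smul]⟩

theorem local_aux {R : Type u} [CommRing R] [IsDomain R] (hp : IsArithmetical R)
    (M : Ideal R) (hM : M.IsMaximal) {G : Type u} [AddCommGroup G] [Module R G]
    (S : Submonoid R) (X : Submodule R (R × G))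
    (hX : ∀ k : G, ((0 : R), k) ∈ X → ∃ s ∈ S, s • k = 0)
    (hne : ∃ x ∈ X, x.1 ≠ 0) :
    ∃ N : Submodule R (R × G),
      (∀ k : G, ((0 : R), k) ∈ X → ((0 : R), k) ∈ N → ∃ t, t ∉ M ∧ t • k = 0) ∧
      (∀ x ∈ X, ∃ s ∈ S, s • x ∈ N) := by
  haveI := hM.isPrime
  have h1M : (1 : R) ∉ M := (Ideal.ne_top_iff_one M).1 Ideal.IsPrime.ne_top'
  have mulM : ∀ {a b : R}, a ∉ M → b ∉ M → a * b ∉ M := fun ha hb => M.primeCompl.mul_mem ha hb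
  by_cases hpr : ∃ x₀ ∈ X, x₀.1 ≠ 0 ∧ ∀ x ∈ X, ∃ s ∈ S, ∃ t, t ∉ M ∧ ∃ r, t * (s * x.1) = r * x₀.1
  · obtain ⟨x₀, hx₀, h0, hd⟩ := hpr
    refine ⟨localPrincipal M x₀, ?_, ?_⟩
    · rintro k - ⟨t, ht, r, h⟩
      have h1 := congrArg Prod.fst h
      have h2 := congrArg Prod.snd h
      simp only [Prod.smul_fst, Prod.smul_snd, smul_eq_mul, mul_zero] at h1 h2
      have hr : r = 0 := by
        rcases mul_eq_zero.1 h1.symm with h | h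
        · exact h
        · exact absurd h h0
      exact ⟨t, ht, by rw [h2, hr, zero_smul]⟩
    · intro x hx
      obtain ⟨s, hs, t, ht, r, h⟩ := hd x hx
      have hk : ((0 : R), (t * s) • x.2 - r • x₀.2) ∈ X := by
        have := X.sub_mem (X.smul_mem (t * s) hx) (X.smul_mem r hx₀)
        convert this using 1
        ext
        · simp [← h, mul_assoc]
        · simp
      obtain ⟨s', hs', hk'⟩ := hX _ hk
      refine ⟨s' * s, S.mul_mem hs' hs, t, ht, s' * r, ?_⟩
      ext
      · simp only [Prod.smul_fst, smul_eq_mul]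
        linear_combination s' * h
      · simp only [Prod.smul_snd]
        rw [smul_sub, sub_eq_zero] at hk'
        rw [mul_smul s' r, ← hk', smul_smul, smul_smul]
        congr 1
        ring
  · push Not at hpr
    let p : Ideal R :=
      { carrier := {r | ∀ s ∈ S, ∃ t, t ∉ M ∧ ∃ v, t * r = v * s}
        zero_mem' := fun s _ => ⟨1, h1M, 0, by simp⟩
        add_mem' := by
          intro a b ha hb s hs
          obtain ⟨t, ht, v, h⟩ := ha s hs
          obtain ⟨t', ht', v', h'⟩ := hb s hs
          exact ⟨t * t', mulM ht ht', t' * v + t * v',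
            by linear_combination t' * h + t * h'⟩
        smul_mem' := by
          intro c a ha s hs
          obtain ⟨t, ht, v, h⟩ := ha s hs
          exact ⟨t, ht, c * v, by rw [smul_eq_mul]; linear_combination c * h⟩ }
    have kill : ∀ r ∈ p, ∀ k : G, ((0 : R), k) ∈ X → ∃ t, t ∉ M ∧ (t * r) • k = 0 := by
      intro r hr k hk
      obtain ⟨s, hs, hsk⟩ := hX k hk
      obtain ⟨t, ht, v, h⟩ := hr s hs
      exact ⟨t, ht, by rw [h, mul_smul, hsk, smul_zero]⟩
    have half : ∀ r ∈ p, ∀ r' ∈ p, ∀ y ∈ X, ∀ y' ∈ X,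
        (∃ t, t ∉ M ∧ ∃ u, t * y'.1 = u * y.1) →
        ∃ t, t ∉ M ∧ ∃ ρ ∈ p, ∃ z ∈ X, t • (r • y + r' • y') = ρ • z := by
      rintro r hr r' hr' y hy y' hy' ⟨t, ht, u, h⟩
      have hk : ((0 : R), t • y'.2 - u • y.2) ∈ X := by
        have := X.sub_mem (X.smul_mem t hy') (X.smul_mem u hy)
        convert this using 1
        ext
        · simp [← h]
        · simp
      obtain ⟨t₁, ht₁, hk'⟩ := kill r' hr' _ hk
      refine ⟨t₁ * t, mulM ht₁ ht, (t₁ * t) * r + (t₁ * u) * r',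
        p.add_mem (p.mul_mem_left _ hr) (p.mul_mem_left _ hr'), y, hy, ?_⟩
      ext
      · simp only [Prod.smul_fst, Prod.fst_add, smul_eq_mul]
        linear_combination t₁ * r' * h
      · simp only [Prod.smul_snd, Prod.snd_add]
        rw [smul_sub, sub_eq_zero] at hk'
        have e : (t₁ * t * r') • y'.2 = (t₁ * u * r') • y.2 := by
          convert hk' using 1
          · rw [smul_smul]; congr 1; ring
          · rw [smul_smul]; congr 1; ring
        rw [smul_add, smul_smul, smul_smul, e, add_smul]
    have both : ∀ r ∈ p, ∀ r' ∈ p, ∀ y ∈ X, ∀ y' ∈ X,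
        ∃ t, t ∉ M ∧ ∃ ρ ∈ p, ∃ z ∈ X, t • (r • y + r' • y') = ρ • z := by
      intro r hr r' hr' y hy y' hy'
      rcases chain_aux hp M hM y'.1 y.1 with h | h
      · exact half r hr r' hr' y hy y' hy' h
      · rw [add_comm]
        exact half r' hr' r hr y' hy' y hy h
    let N : Submodule R (R × G) :=
      { carrier := {x | ∃ t, t ∉ M ∧ ∃ r ∈ p, ∃ y ∈ X, t • x = r • y}
        zero_mem' := ⟨1, h1M, 0, p.zero_mem, 0, X.zero_mem, by simp⟩
        add_mem' := by
          rintro x x' ⟨t, ht, r, hr, y, hy, h⟩ ⟨t', ht', r', hr', y', hy', h'⟩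
          obtain ⟨t₁, ht₁, ρ, hρ, z, hz, e⟩ :=
            both (t' * r) (p.mul_mem_left _ hr) (t * r') (p.mul_mem_left _ hr') y hy y' hy'
          refine ⟨t₁ * (t * t'), mulM ht₁ (mulM ht ht'), ρ, hρ, z, hz, ?_⟩
          rw [← e, mul_smul t' r, ← h, mul_smul t r', ← h', mul_smul, smul_add, mul_comm t t',
            mul_smul, mul_comm t' t, mul_smul]
        smul_mem' := by
          rintro c x ⟨t, ht, r, hr, y, hy, h⟩
          exact ⟨t, ht, c * r, p.mul_mem_left _ hr, y, hy, by rw [smul_comm, h, mul_smul]⟩ }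
    refine ⟨N, ?_, ?_⟩
    · rintro k - ⟨t, ht, r, hr, ⟨c, g⟩, hy, h⟩
      have h1 := congrArg Prod.fst h
      have h2 := congrArg Prod.snd h
      simp only [Prod.smul_fst, Prod.smul_snd, smul_eq_mul, mul_zero] at h1 h2
      rcases mul_eq_zero.1 h1.symm with h0 | h0
      · exact ⟨t, ht, by rw [h2, h0, zero_smul]⟩
      · subst h0
        obtain ⟨t', ht', e⟩ := kill r hr g hy
        exact ⟨t' * t, mulM ht' ht, by rw [mul_smul, h2, ← mul_smul, e]⟩
    · intro x hx
      by_cases hx0 : x.1 = 0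
      · obtain ⟨s, hs, e⟩ := hX x.2 (by rw [← hx0]; exact hx)
        refine ⟨s, hs, ?_⟩
        have : s • x = 0 := by
          ext
          · simp [hx0]
          · simpa using e
        rw [this]
        exact N.zero_mem
      · obtain ⟨y, hy, hc⟩ := hpr x hx hx0
        rcases chain_aux hp M hM x.1 y.1 with ⟨t, ht, r, h⟩ | ⟨t, ht, r, h⟩
        · have hr : r ∈ p := by
            intro s hs
            rcases chain_aux hp M hM r s with h' | ⟨t', ht', r', h'⟩
            · exact h'
            · exact absurd (by linear_combination y.1 * h' - r' * h) (hc s hs t' ht' (r' * t))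
          have hk : ((0 : R), t • x.2 - r • y.2) ∈ X := by
            have := X.sub_mem (X.smul_mem t hx) (X.smul_mem r hy)
            convert this using 1
            ext
            · simp [← h]
            · simp
          obtain ⟨s, hs, e⟩ := hX _ hk
          refine ⟨s, hs, t, ht, s * r, p.mul_mem_left _ hr, y, hy, ?_⟩
          ext
          · simp only [Prod.smul_fst, smul_eq_mul]
            linear_combination s * h
          · simp only [Prod.smul_snd]
            rw [smul_sub, sub_eq_zero] at e
            rw [mul_smul s r, ← e, smul_comm]
        · exact absurd (by rw [one_mul]; exact h) (hc 1 S.one_mem t ht r)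

theorem global_aux {R : Type u} [CommRing R] [IsDomain R] (hp : IsArithmetical R)
    (hfc : FiniteCharacter R) {G : Type u} [AddCommGroup G] [Module R G]
    (S : Submonoid R) (X : Submodule R (R × G))
    (hX : ∀ k : G, ((0 : R), k) ∈ X → ∃ s ∈ S, s • k = 0)
    (hne : ∃ x ∈ X, x.1 ≠ 0) :
    ∃ L : Submodule R (R × G), (∀ k : G, ((0 : R), k) ∈ L → k = 0) ∧
      (∀ x ∈ X, ∃ s ∈ S, s • x ∈ L) := by
  classical
  obtain ⟨x₀, hx₀, h0⟩ := hne
  have hloc : ∀ M : Ideal R, ∃ N : Submodule R (R × G), M.IsMaximal →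
      (∀ k : G, ((0 : R), k) ∈ X → ((0 : R), k) ∈ N → ∃ t, t ∉ M ∧ t • k = 0) ∧
      (∀ x ∈ X, ∃ s ∈ S, s • x ∈ N) ∧
      (x₀.1 ∉ M → ∀ x : R × G, (∃ r : R, x₀.1 • x = r • x₀) → x ∈ N) := by
    intro M
    by_cases hM : M.IsMaximal
    · haveI := hM.isPrime
      by_cases hxM : x₀.1 ∈ M
      · obtain ⟨N, h1, h2⟩ := local_aux hp M hM S X hX ⟨x₀, hx₀, h0⟩
        exact ⟨N, fun _ => ⟨h1, h2, fun h => absurd hxM h⟩⟩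
      · have h3 : ∀ x : R × G, (∃ r : R, x₀.1 • x = r • x₀) → x ∈ localPrincipal M x₀ :=
          fun x hx => ⟨x₀.1, hxM, hx⟩
        refine ⟨localPrincipal M x₀, fun _ => ⟨?_, ?_, fun _ => h3⟩⟩
        · rintro k - ⟨t, ht, r, h⟩
          have h1 := congrArg Prod.fst h
          have h2 := congrArg Prod.snd h
          simp only [Prod.smul_fst, Prod.smul_snd, smul_eq_mul, mul_zero] at h1 h2
          have hr : r = 0 := by
            rcases mul_eq_zero.1 h1.symm with h | h
            · exact h
            · exact absurd h h0
          exact ⟨t, ht, by rw [h2, hr, zero_smul]⟩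
        · intro x hx
          have hk : ((0 : R), x₀.1 • x.2 - x.1 • x₀.2) ∈ X := by
            have := X.sub_mem (X.smul_mem x₀.1 hx) (X.smul_mem x.1 hx₀)
            convert this using 1
            ext
            · simp [mul_comm]
            · simp
          obtain ⟨s, hs, e⟩ := hX _ hk
          refine ⟨s, hs, h3 _ ⟨s * x.1, ?_⟩⟩
          rw [smul_sub, sub_eq_zero] at e
          ext
          · simp only [Prod.smul_fst, smul_eq_mul]; ring
          · simp only [Prod.smul_snd]
            rw [mul_smul, ← e, smul_comm]
    · exact ⟨⊥, fun h => absurd h hM⟩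
  choose N hN using hloc
  refine ⟨X ⊓ ⨅ (M : Ideal R) (_ : M.IsMaximal), N M, ?_, ?_⟩
  · rintro k ⟨hkX, hk⟩
    simp only [SetLike.mem_coe, Submodule.mem_iInf] at hk
    by_contra hk0
    have hne : LinearMap.ker (LinearMap.toSpanSingleton R G k) ≠ ⊤ := by
      intro h
      apply hk0
      have : (1 : R) ∈ LinearMap.ker (LinearMap.toSpanSingleton R G k) := by rw [h]; trivial
      simpa using this
    obtain ⟨M, hM, hle⟩ := Ideal.exists_le_maximal _ hne
    obtain ⟨t, ht, e⟩ := (hN M hM).1 k hkX (hk M hM)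
    exact ht (hle (by simpa using e))
  · intro x hx
    have hk : ((0 : R), x₀.1 • x.2 - x.1 • x₀.2) ∈ X := by
      have := X.sub_mem (X.smul_mem x₀.1 hx) (X.smul_mem x.1 hx₀)
      convert this using 1
      ext
      · simp [mul_comm]
      · simp
    obtain ⟨s, hs, e⟩ := hX _ hk
    rw [smul_sub, sub_eq_zero] at e
    have hfin := hfc x₀.1 h0
    have hd : ∀ M : Ideal R, ∃ s ∈ S, M.IsMaximal → s • x ∈ N M := by
      intro M
      by_cases hM : M.IsMaximal
      · obtain ⟨s, hs, h⟩ := (hN M hM).2.1 x hx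
        exact ⟨s, hs, fun _ => h⟩
      · exact ⟨1, S.one_mem, fun h => absurd h hM⟩
    choose σ hσ hσ' using hd
    refine ⟨(∏ M ∈ hfin.toFinset, σ M) * s, S.mul_mem (S.prod_mem fun M _ => hσ M) hs,
      X.smul_mem _ hx, ?_⟩
    simp only [SetLike.mem_coe, Submodule.mem_iInf]
    intro M hM
    by_cases hxM : x₀.1 ∈ M
    · have hmem : M ∈ hfin.toFinset := by simp [hM, hxM]
      rw [← Finset.mul_prod_erase _ _ hmem]
      rw [mul_assoc, mul_comm, mul_smul]
      exact (N M).smul_mem _ (hσ' M hM)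
    · rw [mul_smul]
      refine (N M).smul_mem _ ((hN M hM).2.2 hxM _ ⟨s * x.1, ?_⟩)
      ext
      · simp only [Prod.smul_fst, smul_eq_mul]; ring
      · simp only [Prod.smul_snd]
        rw [mul_smul, ← e, smul_comm]

/-- Over a Prüfer domain of finite character, every localization of an
injective module is injective. -/
theorem localization_injective_of_pruferDomain_finiteCharacter (R : Type u) [CommRing R]
    [IsDomain R] (hprufer : IsArithmetical R) (hfc : FiniteCharacter R)
    (G : Type u) [AddCommGroup G] [Module R G] (hG : Module.Injective R G)
    (S : Submonoid R) :
    Module.Injective R (LocalizedModule S G) := by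
  let φ : G →ₗ[R] LocalizedModule S G := LocalizedModule.mkLinearMap S G
  have hsurj : Function.Surjective φ := by
    intro q
    obtain ⟨⟨g, s⟩, h⟩ := IsLocalizedModule.surj S φ q
    simp only at h
    by_cases hs : (s : R) = 0
    · refine ⟨0, ?_⟩
      apply IsLocalizedModule.smul_injective φ s
      simp [Submonoid.smul_def, hs]
    · obtain ⟨u, hu⟩ := hG.out (LinearMap.mulLeft R (s : R)) (mul_right_injective₀ hs)
        (LinearMap.toSpanSingleton R G g)
      refine ⟨u 1, ?_⟩
      apply IsLocalizedModule.smul_injective φ s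
      have := hu 1
      simp only [LinearMap.mulLeft_apply, LinearMap.toSpanSingleton_apply, one_smul] at this
      change s • φ (u 1) = s • q
      rw [h, ← this, Submonoid.smul_def, ← map_smul, ← map_smul, smul_eq_mul]
  apply Module.Baer.injective
  intro I f
  by_cases hI : I = ⊥
  · subst hI
    refine ⟨0, fun x hx => ?_⟩
    have : (⟨x, hx⟩ : (⊥ : Ideal R)) = 0 := by
      exact Subsingleton.elim _ _
    rw [this]; simp
  obtain ⟨a, ha, ha0⟩ := Submodule.exists_mem_ne_zero_of_ne_bot hI
  let X : Submodule R (R × G) :=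
    { carrier := {x | ∃ h : x.1 ∈ I, f ⟨x.1, h⟩ = φ x.2}
      zero_mem' := ⟨I.zero_mem, by
        have : (⟨(0 : R × G).1, I.zero_mem⟩ : I) = 0 := rfl
        rw [this]; simp⟩
      add_mem' := by
        rintro x y ⟨hx, ex⟩ ⟨hy, ey⟩
        refine ⟨I.add_mem hx hy, ?_⟩
        rw [Prod.snd_add, map_add, ← ex, ← ey, ← map_add]
        rfl
      smul_mem' := by
        rintro c x ⟨hx, ex⟩
        refine ⟨I.mul_mem_left c hx, ?_⟩
        rw [Prod.smul_snd, map_smul, ← ex, ← map_smul]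
        rfl }
  have hlift : ∀ i (hi : i ∈ I), ∃ g, f ⟨i, hi⟩ = φ g := fun i hi =>
    (hsurj (f ⟨i, hi⟩)).imp fun _ h => h.symm
  have hX : ∀ k : G, ((0 : R), k) ∈ X → ∃ s ∈ S, s • k = 0 := by
    rintro k ⟨h, e⟩
    have h0 : (⟨((0 : R), k).1, h⟩ : I) = 0 := rfl
    rw [h0, map_zero] at e
    obtain ⟨s, hs⟩ := (IsLocalizedModule.eq_zero_iff S φ).1 e.symm
    exact ⟨s, s.2, hs⟩
  obtain ⟨L, hL, hd⟩ := global_aux hprufer hfc S X hX (by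
    obtain ⟨g, hg⟩ := hlift a ha
    exact ⟨(a, g), ⟨ha, hg⟩, ha0⟩)
  obtain ⟨u, hu⟩ := hG.out ((LinearMap.fst R R G).comp L.subtype) (by
      rw [← LinearMap.ker_eq_bot, LinearMap.ker_eq_bot']
      rintro ⟨⟨c, g⟩, hm⟩ h
      have hc : c = 0 := h
      subst hc
      have := hL g hm
      subst this
      rfl) ((LinearMap.snd R R G).comp L.subtype)
  refine ⟨φ.comp u, fun i hi => ?_⟩
  obtain ⟨g, hg⟩ := hlift i hi
  obtain ⟨s, hs, hm⟩ := hd (i, g) ⟨hi, hg⟩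
  have e : u (s • i) = s • g := hu ⟨_, hm⟩
  apply IsLocalizedModule.smul_injective φ (⟨s, hs⟩ : S)
  change s • φ (u i) = s • f ⟨i, hi⟩
  rw [hg, ← map_smul, ← map_smul, e, map_smul]
end

section
/- Let R be a semilocal Prüfer domain (a Prüfer domain with only finitely many maximal ideals). Then for every injective R-module G and every multiplicative subset S of R, the localization S^{-1}G is an injective R-module. -/
universe u

section LocInj
variable {R : Type u} [CommRing R]

lemma li_val [IsDomain R] (h : IsArithmetical R) {m : Ideal R} (hm : m.IsMaximal) (a b : R) :
    ∃ u, u ∉ m ∧ ∃ c, u * a = c * b ∨ u * b = c * a := by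
  have := hm.isPrime
  have key : ∀ a b : R,
      Ideal.span {algebraMap R (Localization.AtPrime m) a} ≤
        Ideal.span {algebraMap R (Localization.AtPrime m) b} → ∃ u, u ∉ m ∧ ∃ c, u * a = c * b := by
    intro a b hab
    rw [Ideal.span_singleton_le_span_singleton] at hab
    obtain ⟨z, hz⟩ := hab
    obtain ⟨⟨c, u⟩, hc⟩ := IsLocalization.surj m.primeCompl z
    refine ⟨u, u.2, c, ?_⟩
    apply IsLocalization.injective (Localization.AtPrime m) m.primeCompl_le_nonZeroDivisors
    simp only [map_mul]
    simp only at hc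
    rw [hz, ← hc]; ring
  rcases h m hm (Ideal.span {algebraMap R _ a}) (Ideal.span {algebraMap R _ b}) with h1 | h1
  · obtain ⟨u, hu, c, hc⟩ := key _ _ h1
    exact ⟨u, hu, c, Or.inl hc⟩
  · obtain ⟨u, hu, c, hc⟩ := key _ _ h1
    exact ⟨u, hu, c, Or.inr hc⟩

lemma li_comp [IsDomain R] (h : IsArithmetical R) {m : Ideal R} (hm : m.IsMaximal) {p q : Ideal R}
    (hp : p.IsPrime) (hq : q.IsPrime) (hpm : p ≤ m) (hqm : q ≤ m) : p ≤ q ∨ q ≤ p := by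
  by_contra! hcon
  obtain ⟨a, hap, haq⟩ := SetLike.not_le_iff_exists.1 hcon.1
  obtain ⟨b, hbq, hbp⟩ := SetLike.not_le_iff_exists.1 hcon.2
  obtain ⟨u, hu, c, hc | hc⟩ := li_val h hm a b
  · have : u * a ∈ q := hc ▸ q.mul_mem_left _ hbq
    exact (hq.mem_or_mem this).elim (fun h => hu (hqm h)) haq
  · have : u * b ∈ p := hc ▸ p.mul_mem_left _ hap
    exact (hp.mem_or_mem this).elim (fun h => hu (hpm h)) hbp

lemma li_flat [IsDomain R] (h : IsArithmetical R) (I : Ideal R) : Module.Flat R I := by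
  rw [Module.Flat.flat_iff_torsion_eq_bot_of_valuationRing_localization_isMaximal]
  · rw [← Submodule.isTorsionFree_iff_torsion_eq_bot]
    infer_instance
  · intro P hP
    have := hP.isPrime
    have : IsDomain (Localization P.primeCompl) :=
      IsLocalization.isDomain_localization P.primeCompl_le_nonZeroDivisors
    rw [ValuationRing.iff_ideal_total]
    exact ⟨h P hP⟩

/-- contraction of the localization of `A` at the prime `m`. -/
def liContr (A m : Ideal R) (hm : m.IsPrime) : Ideal R where
  carrier := {r | ∃ u, u ∉ m ∧ u * r ∈ A}
  zero_mem' := ⟨1, fun h => hm.ne_top ((Ideal.eq_top_iff_one _).2 h), by simp⟩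
  add_mem' := by
    rintro a b ⟨u, hu, hua⟩ ⟨v, hv, hvb⟩
    refine ⟨u * v, fun h => (hm.mem_or_mem h).elim hu hv, ?_⟩
    have : u * v * (a + b) = v * (u * a) + u * (v * b) := by ring
    rw [this]
    exact A.add_mem (A.mul_mem_left _ hua) (A.mul_mem_left _ hvb)
  smul_mem' := by
    rintro c x ⟨u, hu, hux⟩
    refine ⟨u, hu, ?_⟩
    have : u * (c • x) = c * (u * x) := by simp; ring
    rw [this]
    exact A.mul_mem_left _ hux

lemma li_contr_le {A m n : Ideal R} (hm : m.IsPrime) (hn : n.IsPrime) (h : liContr A n hn ≤ m) :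
    ∃ Q : Ideal R, Q.IsPrime ∧ A ≤ Q ∧ Q ≤ m ∧ Q ≤ n := by
  obtain ⟨Q, hQ, hAQ, hd⟩ := Ideal.exists_le_prime_disjoint A (m.primeCompl ⊔ n.primeCompl) (by
    rw [Set.disjoint_left]
    intro x hx hx'
    obtain ⟨v, hv, u, hu, rfl⟩ := Submonoid.mem_sup.1 hx'
    exact hv (h ⟨u, hu, by rwa [mul_comm]⟩))
  rw [Set.disjoint_left] at hd
  refine ⟨Q, hQ, hAQ, fun x hx => ?_, fun x hx => ?_⟩
  · by_contra hxm
    exact hd hx ((le_sup_left : m.primeCompl ≤ _) hxm)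
  · by_contra hxm
    exact hd hx ((le_sup_right : n.primeCompl ≤ _) hxm)

lemma li_idem (hfin : {P : Ideal R | P.IsMaximal}.Finite) (A : Ideal R) (C : Set (Ideal R))
    (hAC : ∀ Q : Ideal R, Q.IsPrime → A ≤ Q → ∀ m ∈ C, m.IsMaximal → Q ≤ m →
      ∀ n : Ideal R, n.IsMaximal → Q ≤ n → n ∈ C) :
    ∃ x : R, (∀ m ∈ C, m.IsMaximal → ∃ u, u ∉ m ∧ u * (1 - x) ∈ A) ∧
      ∀ n, n.IsMaximal → n ∉ C → ∃ u, u ∉ n ∧ u * x ∈ A := by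
  classical
  let F : Ideal R → Ideal R := fun m => if hm : m.IsPrime then liContr A m hm else ⊤
  have hF : ∀ m (hm : m.IsPrime), F m = liContr A m hm := fun m hm => by simp [F, hm]
  let s1 := hfin.toFinset.filter (· ∈ C)
  let s2 := hfin.toFinset.filter (· ∉ C)
  have hs1 : ∀ m, m ∈ s1 ↔ m.IsMaximal ∧ m ∈ C := by simp [s1]
  have hs2 : ∀ m, m ∈ s2 ↔ m.IsMaximal ∧ m ∉ C := by simp [s2]
  have htop : s1.inf F ⊔ s2.inf F = ⊤ := by
    by_contra hne
    obtain ⟨k, hk, hle⟩ := Ideal.exists_le_maximal _ hne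
    by_cases hkC : k ∈ C
    · obtain ⟨n, hn, hnk⟩ := (Ideal.IsPrime.inf_le' hk.isPrime).1 (le_sup_right.trans hle)
      obtain ⟨hnM, hnC⟩ := (hs2 n).1 hn
      rw [hF n hnM.isPrime] at hnk
      obtain ⟨Q, hQ, hAQ, h1, h2⟩ := li_contr_le hk.isPrime _ hnk
      exact hnC (hAC Q hQ hAQ k hkC hk h1 n hnM h2)
    · obtain ⟨n, hn, hnk⟩ := (Ideal.IsPrime.inf_le' hk.isPrime).1 (le_sup_left.trans hle)
      obtain ⟨hnM, hnC⟩ := (hs1 n).1 hn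
      rw [hF n hnM.isPrime] at hnk
      obtain ⟨Q, hQ, hAQ, h1, h2⟩ := li_contr_le hk.isPrime _ hnk
      exact hkC (hAC Q hQ hAQ n hnC hnM h2 k hk h1)
  obtain ⟨y, hy, x, hx, hyx⟩ := Submodule.mem_sup.1 ((Ideal.eq_top_iff_one _).1 htop)
  refine ⟨x, fun m hmC hm => ?_, fun n hn hnC => ?_⟩
  · have h1 := (Finset.inf_le ((hs1 m).2 ⟨hm, hmC⟩) : _ ≤ F m) hy
    rw [hF m hm.isPrime] at h1
    rw [← hyx, add_sub_cancel_right]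
    exact h1
  · have h1 := (Finset.inf_le ((hs2 n).2 ⟨hn, hnC⟩) : _ ≤ F n) hx
    rw [hF n hn.isPrime] at h1
    exact h1

/-- The multiplicative set attached to `(P, C)`. -/
def liS (P : Ideal R) (hP : P.IsPrime) (C : Set (Ideal R)) : Submonoid R where
  carrier := {s | s ∉ P ∧ ∀ n : Ideal R, n.IsMaximal → n ∉ C → s ∉ n}
  one_mem' := ⟨fun h => hP.ne_top ((Ideal.eq_top_iff_one _).2 h),
    fun n hn _ h => hn.ne_top ((Ideal.eq_top_iff_one _).2 h)⟩
  mul_mem' := by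
    rintro a b ⟨h1, h2⟩ ⟨h3, h4⟩
    exact ⟨fun h => (hP.mem_or_mem h).elim h1 h3, fun n hn hnC h =>
      (hn.isPrime.mem_or_mem h).elim (h2 n hn hnC) (h4 n hn hnC)⟩

lemma li_avoid (hfin : {P : Ideal R | P.IsMaximal}.Finite) {P : Ideal R} (hP : P.IsPrime)
    (C : Set (Ideal R)) (J : Ideal R) (h1 : ¬ J ≤ P)
    (h2 : ∀ n : Ideal R, n.IsMaximal → n ∉ C → ¬ J ≤ n) : ∃ s ∈ liS P hP C, s ∈ J := by
  by_contra! hcon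
  have hfin' : (insert P {n : Ideal R | n.IsMaximal ∧ n ∉ C}).Finite :=
    (hfin.subset (fun n hn => hn.1)).insert P
  have := (Ideal.subset_union_prime_finite hfin' (f := id) P P (I := J) (by
    rintro i (rfl | hi) h _
    · exact hP
    · exact hi.1.isPrime)).1 (by
      intro s hs
      simp only [Set.mem_iUnion]
      by_contra hc
      push Not at hc
      refine hcon s ⟨hc P (by simp), fun n hn hnC => hc n (Or.inr ⟨hn, hnC⟩)⟩ hs)
  obtain ⟨i, rfl | hi, hJ⟩ := this
  · exact h1 hJ
  · exact h2 i hi.1 hi.2 hJ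

lemma li_top_of {J : Ideal R} (h : ∀ m : Ideal R, m.IsMaximal → ∃ u, u ∉ m ∧ u ∈ J) :
    (1 : R) ∈ J := by
  rw [← Ideal.eq_top_iff_one]
  by_contra hne
  obtain ⟨k, hk, hle⟩ := Ideal.exists_le_maximal _ hne
  obtain ⟨u, hu, huJ⟩ := h k hk
  exact hu (hle huJ)

lemma li_dvd [IsDomain R] (h : IsArithmetical R) {P : Ideal R} (hP : P.IsPrime) (C : Set (Ideal R))
    (hPC : ∀ m ∈ C, P ≤ m) {s p : R} (hs : s ∈ liS P hP C) (hp : p ∈ P) : s ∣ p := by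
  have : (1 : R) ∈ (Ideal.span {s}).colon {p} := by
    apply li_top_of
    intro m hm
    by_cases hmC : m ∈ C
    · obtain ⟨u, hu, c, hc | hc⟩ := li_val h hm p s
      · refine ⟨u, hu, ?_⟩
        rw [Submodule.mem_colon_singleton, smul_eq_mul, hc]
        exact Ideal.mul_mem_left _ _ (Ideal.mem_span_singleton_self s)
      · have : u * s ∈ P := hc ▸ P.mul_mem_left _ hp
        exact ((hP.mem_or_mem this).elim (fun h => hu (hPC m hmC h)) hs.1).elim
    · refine ⟨s, hs.2 m hm hmC, ?_⟩
      rw [Submodule.mem_colon_singleton, smul_eq_mul, mul_comm]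
      exact Ideal.mul_mem_left _ _ (Ideal.mem_span_singleton_self s)
  rw [Submodule.mem_colon_singleton, one_smul] at this
  exact Ideal.mem_span_singleton.1 this

lemma li_ext {P : Ideal R} {Q A B : Type u} [AddCommGroup Q] [Module R Q] [AddCommGroup A]
    [Module R A] [AddCommGroup B] [Module R B]
    (hQ : ∀ p ∈ P, ∀ x : Q, p • x = 0) (hB : ∀ p ∈ P, ∀ x : B, p • x = 0)
    (hbaer : ∀ (J : Ideal R) (f : J →ₗ[R] Q), P ≤ J → (∀ j : J, (j : R) ∈ P → f j = 0) →
      ∃ e : Q, ∀ j : J, f j = (j : R) • e)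
    (i : A →ₗ[R] B) (hi : Function.Injective i) (f : A →ₗ[R] Q) :
    ∃ g : B →ₗ[R] Q, g ∘ₗ i = f := by
  have hA : ∀ p ∈ P, ∀ x : A, p • x = 0 := fun p hp x => hi (by
    rw [map_smul, hB p hp, map_zero])
  have tQ : Module.IsTorsionBySet R Q P := fun x p => hQ p p.2 x
  have tA : Module.IsTorsionBySet R A P := fun x p => hA p p.2 x
  have tB : Module.IsTorsionBySet R B P := fun x p => hB p p.2 x
  let _ := tQ.module
  let _ := tA.module
  let _ := tB.module
  have hBaer : Module.Baer (R ⧸ P) Q := by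
    intro I g
    let J : Ideal R := I.comap (Ideal.Quotient.mk P)
    let f' : J →ₗ[R] Q :=
      { toFun := fun j => g ⟨Ideal.Quotient.mk P j, j.2⟩
        map_add' := fun a b => by
          rw [← map_add]; rfl
        map_smul' := fun r a => by
          have := g.map_smul (Ideal.Quotient.mk P r) ⟨Ideal.Quotient.mk P a, a.2⟩
          exact this }
    obtain ⟨e, he⟩ := hbaer J f' (fun p hp => by
        change Ideal.Quotient.mk P p ∈ I
        rw [Ideal.Quotient.eq_zero_iff_mem.2 hp]; exact I.zero_mem) (fun j hj => by
        change g ⟨Ideal.Quotient.mk P j, j.2⟩ = 0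
        have : (⟨Ideal.Quotient.mk P j, j.2⟩ : I) = 0 :=
          Subtype.ext (Ideal.Quotient.eq_zero_iff_mem.2 hj)
        rw [this, map_zero])
    refine ⟨LinearMap.toSpanSingleton (R ⧸ P) Q e, ?_⟩
    intro x hx
    obtain ⟨r, rfl⟩ := Ideal.Quotient.mk_surjective x
    exact (he ⟨r, hx⟩).symm
  let i' : A →ₗ[R ⧸ P] B := { i with
    map_smul' := by
      intro r x
      obtain ⟨r, rfl⟩ := Ideal.Quotient.mk_surjective r
      exact i.map_smul r x }
  let f' : A →ₗ[R ⧸ P] Q := { f with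
    map_smul' := by
      intro r x
      obtain ⟨r, rfl⟩ := Ideal.Quotient.mk_surjective r
      exact f.map_smul r x }
  obtain ⟨g, hg⟩ := hBaer.extension_property i' hi f'
  refine ⟨{ g with map_smul' := fun r x => g.map_smul (Ideal.Quotient.mk P r) x }, ?_⟩
  ext x
  exact LinearMap.congr_fun hg x

lemma li_lift {P : Ideal R} {I G H : Type u} [AddCommGroup I] [Module R I] [Module.Flat R I]
    [AddCommGroup G] [Module R G] [AddCommGroup H] [Module R H]
    (f : G →ₗ[R] H) (hf : Function.Surjective f)
    (hQ : ∀ p ∈ P, ∀ x ∈ LinearMap.ker f, p • x = 0)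
    (hbaer : ∀ (J : Ideal R) (f' : J →ₗ[R] LinearMap.ker f), P ≤ J →
      (∀ j : J, (j : R) ∈ P → f' j = 0) →
      ∃ e : LinearMap.ker f, ∀ j : J, f' j = (j : R) • e)
    (q : I →ₗ[R] H) : ∃ φ : I →ₗ[R] G, f ∘ₗ φ = q := by
  obtain ⟨Y, hY⟩ : ∃ Y : Submodule R (I × G), ∀ y : I × G, y ∈ Y ↔ q y.1 = f y.2 :=
    ⟨LinearMap.ker (q ∘ₗ LinearMap.fst R I G - f ∘ₗ LinearMap.snd R I G), fun y => by
      simp [LinearMap.mem_ker, sub_eq_zero]⟩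
  let N : Submodule R Y := P • ⊤
  let j0 : LinearMap.ker f →ₗ[R] Y :=
    { toFun := fun t => ⟨(0, t), by
        rw [hY]; simp only [map_zero]; exact (LinearMap.mem_ker.1 t.2).symm⟩
      map_add' := fun a b => by ext <;> simp
      map_smul' := fun r a => by ext <;> simp }
  have key : ∀ y ∈ N, y.1.1 = 0 → y = 0 := by
    intro y hy hy0
    have hy' : y ∈ P • Submodule.span R (Set.range (id : Y → Y)) := by simpa [N] using hy
    rw [Submodule.mem_ideal_smul_span_iff_exists_sum] at hy'
    obtain ⟨a, ha, hsum⟩ := hy'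
    have hs : ∑ k : a.support, a k • (k : Y) = y := by
      rw [← hsum, Finsupp.sum]
      exact Finset.sum_coe_sort a.support (fun k => a k • k)
    have h0 : ∑ k : a.support, a k • (k : Y).1.1 = 0 := by
      rw [← hy0, ← hs]
      simp [Prod.fst_sum]
    obtain ⟨n, b, d, hd, hb⟩ := Module.Flat.isTrivialRelation_of_sum_smul_eq_zero h0
    choose g hg using fun l => hf (q (d l))
    let z : Fin n → Y := fun l => ⟨(d l, g l), by rw [hY]; exact (hg l).symm⟩
    have hk : ∀ k : a.support, a k • (k : Y) = a k • ∑ l, b k l • z l := by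
      intro k
      refine sub_eq_zero.1 ((smul_sub _ _ _).symm.trans ?_)
      have h1 : ((k : Y) - ∑ l, b k l • z l).1.1 = 0 := by
        have : (∑ l, b k l • z l).1.1 = ∑ l, b k l • d l := by
          simp [Prod.fst_sum, z]
        rw [Submodule.coe_sub, Prod.fst_sub, this, ← hd k, sub_self]
      generalize (k : Y) - ∑ l, b k l • z l = w at h1
      have h2 : w.1.2 ∈ LinearMap.ker f := by
        rw [LinearMap.mem_ker, ← (hY w.1).1 w.2, h1, map_zero]
      apply Subtype.ext
      apply Prod.ext
      · simp [h1]
      · simpa using hQ _ (ha _) _ h2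
    rw [← hs, Finset.sum_congr rfl (fun k _ => hk k)]
    simp only [Finset.smul_sum, smul_smul]
    rw [Finset.sum_comm]
    simp only [← Finset.sum_smul, hb, zero_smul, Finset.sum_const_zero]
  obtain ⟨ρ, hρ⟩ := li_ext (P := P) (Q := LinearMap.ker f) (A := LinearMap.ker f) (B := Y ⧸ N)
    (fun p hp x => Subtype.ext (hQ p hp x x.2)) (fun p hp x => by
      obtain ⟨y, rfl⟩ := Submodule.mkQ_surjective _ x
      rw [← map_smul, Submodule.mkQ_apply, Submodule.Quotient.mk_eq_zero]
      exact Submodule.smul_mem_smul hp trivial) hbaer (N.mkQ ∘ₗ j0) (by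
      rw [← LinearMap.ker_eq_bot, LinearMap.ker_eq_bot']
      intro t ht
      rw [LinearMap.comp_apply, Submodule.mkQ_apply, Submodule.Quotient.mk_eq_zero] at ht
      have := key _ ht rfl
      exact Subtype.ext (congrArg (fun y : Y => y.1.2) this)) LinearMap.id
  let ψ : Y →ₗ[R] G := LinearMap.snd R I G ∘ₗ Y.subtype -
    (LinearMap.ker f).subtype ∘ₗ ρ ∘ₗ N.mkQ
  let π : Y →ₗ[R] I := LinearMap.fst R I G ∘ₗ Y.subtype
  have hπ : Function.Surjective π := fun i => by
    obtain ⟨g, hg⟩ := hf (q i)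
    exact ⟨⟨(i, g), (hY _).2 hg.symm⟩, rfl⟩
  have hker : LinearMap.ker π ≤ LinearMap.ker ψ := by
    intro y hy
    have hy0 : y.1.1 = 0 := hy
    have h2 : y.1.2 ∈ LinearMap.ker f := by
      rw [LinearMap.mem_ker, ← (hY y.1).1 y.2, hy0, map_zero]
    have hyj : y = j0 ⟨_, h2⟩ := Subtype.ext (Prod.ext hy0 rfl)
    have h3 : ρ (N.mkQ y) = ⟨_, h2⟩ := by
      conv_lhs => rw [hyj]
      exact LinearMap.congr_fun hρ _
    rw [LinearMap.mem_ker]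
    simp only [ψ, LinearMap.sub_apply, LinearMap.comp_apply, h3]
    simp
  have hfψ : ∀ y, f (ψ y) = q (π y) := by
    intro y
    have h4 : f (ρ (N.mkQ y) : G) = 0 := (ρ (N.mkQ y)).2
    have : ψ y = y.1.2 - (ρ (N.mkQ y) : G) := rfl
    rw [this, map_sub, h4, sub_zero]
    exact ((hY y.1).1 y.2).symm
  refine ⟨(LinearMap.ker π).liftQ ψ hker ∘ₗ (π.quotKerEquivOfSurjective hπ).symm.toLinearMap, ?_⟩
  ext i
  obtain ⟨y, rfl⟩ := hπ i
  rw [← hfψ]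
  have : (π.quotKerEquivOfSurjective hπ).symm (π y) = (LinearMap.ker π).mkQ y := by
    rw [LinearEquiv.symm_apply_eq]; rfl
  simp [this]

/-- `H` is (via `f`) the quotient of `G` by its `S`-torsion. -/
def liIs (S : Submonoid R) {G H : Type u} [AddCommGroup G] [Module R G]
    [AddCommGroup H] [Module R H] (f : G →ₗ[R] H) : Prop :=
  Function.Surjective f ∧ ∀ g, f g = 0 ↔ ∃ s ∈ S, s • g = 0

lemma li_step [IsDomain R] (h : IsArithmetical R) (hfin : {P : Ideal R | P.IsMaximal}.Finite)
    {P : Ideal R} (hP : P.IsPrime) (C : Set (Ideal R)) (hPC : ∀ m ∈ C, P ≤ m)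
    (hC : ∀ Q : Ideal R, Q.IsPrime → P < Q → ∀ m ∈ C, m.IsMaximal → Q ≤ m →
      ∀ n : Ideal R, n.IsMaximal → Q ≤ n → n ∈ C)
    {G H : Type u} [AddCommGroup G] [Module R G] [AddCommGroup H] [Module R H]
    (hG : Module.Injective R G) (f : G →ₗ[R] H) (hf : liIs (liS P hP C) f) :
    Module.Injective R H := by
  apply Module.Baer.injective
  intro I q
  have hkill : ∀ p ∈ P, ∀ x ∈ LinearMap.ker f, p • x = 0 := by
    intro p hp x hx
    obtain ⟨s, hs, hsx⟩ := (hf.2 x).1 hx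
    obtain ⟨c, rfl⟩ := li_dvd h hP C hPC hs hp
    rw [mul_comm, mul_smul, hsx, smul_zero]
  have := li_flat h I
  obtain ⟨φ, hφ⟩ := li_lift (P := P) f hf.1 hkill (by
    intro J f' hPJ hf'
    by_cases hJ : J ≤ P
    · exact ⟨0, fun j => by rw [hf' j (hJ j.2), smul_zero]⟩
    obtain ⟨e', he'⟩ := Module.Baer.of_injective hG J ((LinearMap.ker f).subtype ∘ₗ f')
    obtain ⟨e, he⟩ : ∃ e : G, ∀ j (hj : j ∈ J), ((f' ⟨j, hj⟩ : LinearMap.ker f) : G) = j • e :=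
      ⟨e' 1, fun j hj => by
        rw [← map_smul, smul_eq_mul, mul_one, he' j hj]; rfl⟩
    let A : Ideal R := Ideal.torsionOf R G e
    have hA : ∀ r, r ∈ A ↔ r • e = 0 := fun r => Ideal.mem_torsionOf_iff e r
    have hPA : P ≤ A := fun p hp => by
      rw [hA, ← he p (hPJ hp), hf' ⟨p, hPJ hp⟩ hp]; rfl
    have hAP : ¬ A ≤ P := by
      obtain ⟨j, hj, hjP⟩ := SetLike.not_le_iff_exists.1 hJ
      obtain ⟨s, hs, hse⟩ := (hf.2 _).1 (f' ⟨j, hj⟩).2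
      intro hle
      have : s * j ∈ P := hle (by rw [hA, mul_smul, ← he j hj, hse])
      exact (hP.mem_or_mem this).elim hs.1 hjP
    obtain ⟨x, hx1, hx2⟩ := li_idem hfin A C (fun Q hQ hAQ =>
      hC Q hQ (lt_of_le_not_ge (hPA.trans hAQ) (fun hh => hAP (hAQ.trans hh))))
    have hxe : x • e ∈ LinearMap.ker f := by
      obtain ⟨s, hs, hs'⟩ := li_avoid hfin hP C (Ideal.torsionOf R G (x • e))
        (fun hle => hAP (fun r hr => hle (by
          rw [Ideal.mem_torsionOf_iff, smul_comm, (hA r).1 hr, smul_zero])))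
        (fun n hn hnC hle => by
          obtain ⟨u, hu, hux⟩ := hx2 n hn hnC
          exact hu (hle (by rw [Ideal.mem_torsionOf_iff, ← mul_smul]; exact (hA _).1 hux)))
      exact (hf.2 _).2 ⟨s, hs, (Ideal.mem_torsionOf_iff _ _).1 hs'⟩
    refine ⟨⟨x • e, hxe⟩, fun j => Subtype.ext ?_⟩
    have h1 : (1 : R) ∈ Ideal.torsionOf R G ((1 - x) • (j : R) • e) := by
      apply li_top_of
      intro m hm
      by_cases hmC : m ∈ C
      · obtain ⟨u, hu, hux⟩ := hx1 m hmC hm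
        refine ⟨u, hu, ?_⟩
        rw [Ideal.mem_torsionOf_iff, ← mul_smul, smul_comm, (hA _).1 hux, smul_zero]
      · obtain ⟨s, hs, hse⟩ := (hf.2 _).1 (f' j).2
        refine ⟨s, hs.2 m hm hmC, ?_⟩
        rw [Ideal.mem_torsionOf_iff, smul_comm, ← he j j.2, hse, smul_zero]
    rw [Ideal.mem_torsionOf_iff, one_smul, sub_smul, one_smul, sub_eq_zero] at h1
    rw [he j j.2, h1, smul_comm]; rfl) q
  obtain ⟨g', hg'⟩ := Module.Baer.of_injective hG I φ
  exact ⟨f ∘ₗ g', fun x hx => by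
    rw [LinearMap.comp_apply, hg' x hx, ← hφ]; rfl⟩

/-- `S`-torsion. -/
def liTors (S : Submonoid R) (G : Type u) [AddCommGroup G] [Module R G] : Submodule R G where
  carrier := {g | ∃ s ∈ S, s • g = 0}
  zero_mem' := ⟨1, S.one_mem, smul_zero _⟩
  add_mem' := by
    rintro a b ⟨s, hs, hsa⟩ ⟨t, ht, htb⟩
    refine ⟨s * t, S.mul_mem hs ht, ?_⟩
    rw [smul_add, mul_smul s t b, htb, smul_zero, mul_comm, mul_smul, hsa, smul_zero, add_zero]
  smul_mem' := by
    rintro c x ⟨s, hs, hsx⟩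
    exact ⟨s, hs, by rw [smul_comm, hsx, smul_zero]⟩

/-- Localization at `S` preserves injectivity. -/
def liGood (S : Submonoid R) : Prop :=
  ∀ (G H : Type u) [AddCommGroup G] [Module R G] [AddCommGroup H] [Module R H] (f : G →ₗ[R] H),
    Module.Injective R G → liIs S f → Module.Injective R H

lemma li_good_bot : liGood (⊥ : Submonoid R) := by
  intro G H _ _ _ _ f hG hf
  have hinj : Function.Injective f := by
    rw [← LinearMap.ker_eq_bot, LinearMap.ker_eq_bot']
    intro g hg
    obtain ⟨s, hs, hsg⟩ := (hf.2 g).1 hg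
    rw [Submonoid.mem_bot] at hs
    rwa [hs, one_smul] at hsg
  exact ((Module.Baer.of_injective hG).of_equiv
    (LinearEquiv.ofBijective f ⟨hinj, hf.1⟩)).injective

lemma li_good_sup {S S' : Submonoid R} (h : liGood S) (h' : liGood S') : liGood (S ⊔ S') := by
  intro G H _ _ _ _ f hG hf
  have h1 : Module.Injective R (G ⧸ liTors S G) :=
    h G _ (liTors S G).mkQ hG ⟨Submodule.mkQ_surjective _, fun g => by
      rw [Submodule.mkQ_apply, Submodule.Quotient.mk_eq_zero]; rfl⟩
  have hle : liTors S G ≤ LinearMap.ker f := by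
    rintro g ⟨s, hs, hsg⟩
    exact (hf.2 g).2 ⟨s, (le_sup_left : S ≤ S ⊔ S') hs, hsg⟩
  refine h' (G ⧸ liTors S G) H ((liTors S G).liftQ f hle) h1 ⟨?_, ?_⟩
  · intro x
    obtain ⟨g, rfl⟩ := hf.1 x
    exact ⟨(liTors S G).mkQ g, by simp⟩
  · intro x
    obtain ⟨g, rfl⟩ := Submodule.mkQ_surjective _ x
    rw [Submodule.mkQ_apply, Submodule.liftQ_apply, hf.2 g]
    simp only [← Submodule.Quotient.mk_smul, Submodule.Quotient.mk_eq_zero]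
    constructor
    · rintro ⟨s, hs, hsg⟩
      obtain ⟨a, ha, b, hb, rfl⟩ := Submonoid.mem_sup.1 hs
      exact ⟨b, hb, a, ha, by rwa [← mul_smul]⟩
    · rintro ⟨b, hb, a, ha, hab⟩
      exact ⟨a * b, Submonoid.mul_mem_sup ha hb, by rwa [mul_smul]⟩

lemma li_maxprime [IsDomain R] (h : IsArithmetical R) (T : Submonoid R) (h0 : (0 : R) ∉ T)
    (m : Ideal R) : ∃ P : Ideal R, P.IsPrime ∧ (m.IsMaximal → P ≤ m ∧ (∀ t ∈ T, t ∉ P) ∧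
      ∀ Q : Ideal R, Q.IsPrime → Q ≤ m → (∀ t ∈ T, t ∉ Q) → Q ≤ P) := by
  by_cases hm : m.IsMaximal
  swap
  · exact ⟨⊥, Ideal.isPrime_bot, fun hh => (hm hh).elim⟩
  have := hm.isPrime
  let U : Submonoid R := T ⊔ m.primeCompl
  have h0U : Disjoint ((⊥ : Ideal R) : Set R) U := by
    rw [Set.disjoint_left]
    rintro x hx hx'
    obtain ⟨t, ht, v, hv, rfl⟩ := Submonoid.mem_sup.1 hx'
    rcases mul_eq_zero.1 (show t * v = 0 from hx) with rfl | rfl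
    · exact h0 ht
    · exact hv m.zero_mem
  obtain ⟨p, -, hp⟩ := zorn_le_nonempty₀ {p : Ideal R | Disjoint (p : Set R) U}
    (fun c hc hc' x hx ↦ by
      have : Nonempty c := ⟨⟨x, hx⟩⟩
      refine ⟨sSup c, Set.disjoint_left.mpr fun x hx ↦ ?_, fun _ ↦ le_sSup⟩
      have ⟨p, hp⟩ := (Submodule.mem_iSup_of_directed _ hc'.directed).mp (sSup_eq_iSup' c ▸ hx)
      exact Set.disjoint_left.mp (hc p.2) hp) ⊥ h0U
  have hpp := Ideal.isPrime_of_maximally_disjoint _ _ hp.1 (fun _ ↦ hp.not_prop_of_gt)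
  have hd := Set.disjoint_left.1 hp.1
  have hpm : p ≤ m := fun x hx => by
    by_contra hxm
    exact hd hx ((le_sup_right : m.primeCompl ≤ U) hxm)
  refine ⟨p, hpp, fun _ => ⟨hpm, fun t ht htp => hd htp ((le_sup_left : T ≤ U) ht), ?_⟩⟩
  intro Q hQ hQm hQT
  rcases li_comp h hm hpp hQ hpm hQm with hpQ | hQp
  · refine hp.2 ?_ hpQ
    change Disjoint _ _
    rw [Set.disjoint_left]
    rintro x hx hx'
    obtain ⟨t, ht, v, hv, rfl⟩ := Submonoid.mem_sup.1 hx'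
    exact (hQ.mem_or_mem hx).elim (hQT t ht) (fun hh => hv (hQm hh))
  · exact hQp

lemma li_good [IsDomain R] (h : IsArithmetical R) (hfin : {P : Ideal R | P.IsMaximal}.Finite)
    (T : Submonoid R) (h0 : (0 : R) ∉ T) : liGood T := by
  classical
  choose P hP hPm using li_maxprime h T h0
  let C : Ideal R → Set (Ideal R) := fun m =>
    {n | n.IsMaximal ∧ ∃ Q : Ideal R, Q.IsPrime ∧ P m < Q ∧ Q ≤ m ∧ Q ≤ n}
  have hCcl : ∀ m, ∀ Q : Ideal R, Q.IsPrime → P m < Q → ∀ m' ∈ C m, m'.IsMaximal →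
      Q ≤ m' → ∀ n : Ideal R, n.IsMaximal → Q ≤ n → n ∈ C m := by
    rintro m Q hQ hPQ m' ⟨-, Q', hQ', hPQ', hQm, hQm'⟩ hm' hQm2 n hn hQn
    rcases li_comp h hm' hQ hQ' hQm2 hQm' with hle | hle
    · exact ⟨hn, Q, hQ, hPQ, hle.trans hQm, hQn⟩
    · exact ⟨hn, Q', hQ', hPQ', hQm, hle.trans hQn⟩
  have hPC : ∀ m, ∀ m' ∈ C m, P m ≤ m' := by
    rintro m m' ⟨-, Q', hQ', hPQ', hQm, hQm'⟩
    exact hPQ'.le.trans hQm'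
  let F : Ideal R → Submonoid R := fun m => liS (P m) (hP m) (C m)
  let S := hfin.toFinset.sup F
  have hS : liGood S := by
    refine Finset.sup_induction li_good_bot (fun a ha b hb => li_good_sup ha hb) ?_
    intro m _ G H _ _ _ _ f hG hf
    exact li_step h hfin (hP m) (C m) (hPC m) (hCcl m) hG f hf
  have hFS : ∀ m : Ideal R, m.IsMaximal → F m ≤ S := fun m hm =>
    Finset.le_sup (f := F) (by simpa using hm)
  -- elements of `S` divide elements of `T`
  let D : Submonoid R :=
    { carrier := {s | ∃ t ∈ T, s ∣ t}
      one_mem' := ⟨1, T.one_mem, dvd_rfl⟩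
      mul_mem' := by
        rintro a b ⟨t, ht, hat⟩ ⟨t', ht', hbt⟩
        exact ⟨t * t', T.mul_mem ht ht', mul_dvd_mul hat hbt⟩ }
  have hSD : S ≤ D := by
    refine Finset.sup_le ?_
    intro m hm s hs
    have hm : m.IsMaximal := by simpa using hm
    have hsn : ∀ n : Ideal R, n.IsMaximal → s ∉ P n := by
      intro n hn hsP
      by_cases hnC : n ∈ C m
      · refine hs.1 ?_
        obtain ⟨-, Q, hQ, hPQ, hQm, hQn⟩ := hnC
        have h1 : P n ≤ Q := by
          rcases li_comp h hn (hP n) hQ (hPm n hn).1 hQn with hle | hle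
          · exact hle
          · exact (hPQ.not_ge ((hPm m hm).2.2 Q hQ hQm
              (fun t ht htQ => (hPm n hn).2.1 t ht (hle htQ)))).elim
        exact (hPm m hm).2.2 (P n) (hP n) (h1.trans hQm) (hPm n hn).2.1 hsP
      · exact hs.2 n hn hnC ((hPm n hn).1 hsP)
    by_contra hcon
    obtain ⟨Q, hQ, hsQ, hd⟩ := Ideal.exists_le_prime_disjoint (Ideal.span {s}) T (by
      rw [Set.disjoint_left]
      intro t hts ht
      exact hcon ⟨t, ht, Ideal.mem_span_singleton.1 hts⟩)
    obtain ⟨n, hn, hQn⟩ := Ideal.exists_le_maximal Q hQ.ne_top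
    exact hsn n hn ((hPm n hn).2.2 Q hQ hQn (fun t ht htQ => Set.disjoint_left.1 hd htQ ht)
      (hsQ (Ideal.mem_span_singleton_self s)))
  intro G H _ _ _ _ f hG hf
  refine hS G H f hG ⟨hf.1, fun g => ?_⟩
  rw [hf.2 g]
  constructor
  · rintro ⟨t, ht, htg⟩
    let A : Ideal R := (liTors S G).colon {g}
    have hA : ∀ r, r ∈ A ↔ r • g ∈ liTors S G := fun r => Submodule.mem_colon_singleton
    have htA : t ∈ A := by rw [hA, htg]; exact Submodule.zero_mem _
    have h1A : (1 : R) ∈ A := by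
      rw [← Ideal.eq_top_iff_one]
      by_contra hne
      obtain ⟨m, hm, hAm⟩ := Ideal.exists_le_maximal _ hne
      have hPm' := hPm m hm
      have hmC : m ∈ C m := ⟨hm, m, hm.isPrime, lt_of_le_not_ge hPm'.1
        (fun hle => hPm'.2.1 t ht (hle (hAm htA))), le_rfl, le_rfl⟩
      obtain ⟨x, hx1, hx2⟩ := li_idem hfin A (C m) (by
        intro Q hQ hAQ m' hm'C hm' hQm' n hn hQn
        refine hCcl m Q hQ ?_ m' hm'C hm' hQm' n hn hQn
        have hQP : ¬ Q ≤ P m := fun hle => hPm'.2.1 t ht (hle (hAQ htA))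
        rcases li_comp h hm' (hP m) hQ (hPC m m' hm'C) hQm' with hle | hle
        · exact lt_of_le_not_ge hle hQP
        · exact (hQP hle).elim)
      obtain ⟨s, hs, hsx⟩ := li_avoid hfin (hP m) (C m) (A.colon {x})
        (fun hle => hPm'.2.1 t ht (hle (by
          rw [Submodule.mem_colon_singleton, smul_eq_mul]
          exact A.mul_mem_right _ htA)))
        (fun n hn hnC hle => by
          obtain ⟨u, hu, hux⟩ := hx2 n hn hnC
          exact hu (hle (by rwa [Submodule.mem_colon_singleton, smul_eq_mul])))
      rw [Submodule.mem_colon_singleton, smul_eq_mul, hA] at hsx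
      have hxA : x ∈ A := by
        rw [hA]
        obtain ⟨s', hs', hss⟩ := hsx
        exact ⟨s' * s, S.mul_mem hs' (hFS m hm hs), by rwa [mul_smul, ← mul_smul s x g]⟩
      obtain ⟨u, hu, hux⟩ := hx1 m hmC hm
      rcases hm.isPrime.mem_or_mem (hAm hux) with h2 | h2
      · exact hu h2
      · have := m.add_mem h2 (hAm hxA)
        rw [sub_add_cancel] at this
        exact hm.ne_top ((Ideal.eq_top_iff_one _).2 this)
    rw [hA, one_smul] at h1A
    exact h1A
  · rintro ⟨s, hs, hsg⟩
    obtain ⟨t, ht, c, rfl⟩ := hSD hs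
    exact ⟨s * c, ht, by rw [mul_comm, mul_smul, hsg, smul_zero]⟩

lemma li_main [IsDomain R] (h : IsArithmetical R) (hfin : {P : Ideal R | P.IsMaximal}.Finite)
    (G : Type u) [AddCommGroup G] [Module R G] (hG : Module.Injective R G) (S : Submonoid R) :
    Module.Injective R (LocalizedModule S G) := by
  by_cases h0 : (0 : R) ∈ S
  · have : Subsingleton (LocalizedModule S G) := LocalizedModule.subsingleton h0
    exact ⟨fun X Y _ _ _ _ f hf g => ⟨0, fun x => Subsingleton.elim _ _⟩⟩
  · refine li_good h hfin S h0 G _ (LocalizedModule.mkLinearMap S G) hG ⟨?_, ?_⟩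
    · intro x
      induction x using LocalizedModule.induction_on with
      | h g s =>
        have hs0 : (s : R) ≠ 0 := fun hh => h0 (hh ▸ s.2)
        obtain ⟨φ, hφ⟩ := Module.Injective.out (Q := G) (LinearMap.mulLeft R (s : R))
          (mul_right_injective₀ hs0) (LinearMap.toSpanSingleton R G g)
        refine ⟨φ 1, ?_⟩
        have : (s : R) • φ 1 = g := by
          rw [← map_smul, smul_eq_mul]
          have := hφ 1
          simpa using this
        rw [LocalizedModule.mkLinearMap_apply, LocalizedModule.mk_eq]
        refine ⟨1, ?_⟩
        simp only [one_smul]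
        exact this
    · intro g
      rw [IsLocalizedModule.eq_zero_iff S]
      constructor
      · rintro ⟨s, hs⟩; exact ⟨s, s.2, hs⟩
      · rintro ⟨s, hs, hsg⟩; exact ⟨⟨s, hs⟩, hsg⟩

end LocInj

/-- Over a semilocal Prüfer domain, every localization of an injective
module is injective. -/
theorem localization_injective_of_semilocal_pruferDomain (R : Type u) [CommRing R]
    [IsDomain R] (hprufer : IsArithmetical R)
    (hsemilocal : {P : Ideal R | P.IsMaximal}.Finite)
    (G : Type u) [AddCommGroup G] [Module R G] (hG : Module.Injective R G)
    (S : Submonoid R) :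
    Module.Injective R (LocalizedModule S G) := by
  exact li_main hprufer hsemilocal G hG S
end
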